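/- arXiv:2109.05962 — 3 statements merged into one kernel-verified Lean document; each statement's English description precedes it below -/
import Mathlib

section
/- Let {S_j} be a scale sequence, {b_j} a kernel sequence satisfying the flexible-needlet assumptions, and let α > 2, β ∈ [0,1), and g : (0,∞) → (0,∞) be C^∞ with g_1 ≤ g ≤ g_2 (for some g_2 ≥ g_1 > 0) and |g^{(r)}(u)| ≤ A_r u^{−(1−β)r} for all u ≥ 1 and r ≥ 1. Then for every N ∈ ℕ there exists a constant C > 0 (independent of j and u) such that for all j ≥ 1 and all u ∈ [S_{j−1}, S_{j+1}], | d^N/du^N ( b_j(u)² · u^{−α} · g(u) ) | ≤ C · u^{−α} · max{ 1/S_{j−1}^{N(1−β)}, 1/(S_j − S_{j−1})^N }. -/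
/-- Constants produced by the Leibniz rule. -/
noncomputable def leibC (a c : ℕ → ℝ) (n : ℕ) : ℝ :=
  ∑ i ∈ Finset.range (n + 1), (n.choose i : ℝ) * a i * c (n - i)

lemma leib_bound (f h : ℝ → ℝ) (u : ℝ) (a c : ℕ → ℝ) (w₁ w₂ M : ℝ)
    (hfC : ∀ n : ℕ, ContDiffAt ℝ n f u) (hhC : ∀ n : ℕ, ContDiffAt ℝ n h u)
    (hf : ∀ n, |iteratedDeriv n f u| ≤ a n * w₁ * M ^ n)
    (hh : ∀ n, |iteratedDeriv n h u| ≤ c n * w₂ * M ^ n) (n : ℕ) :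
    |iteratedDeriv n (fun v => f v * h v) u| ≤ leibC a c n * (w₁ * w₂) * M ^ n := by
  rw [iteratedDeriv_fun_mul (hfC n) (hhC n), leibC, Finset.sum_mul, Finset.sum_mul]
  refine (Finset.abs_sum_le_sum_abs _ _).trans (Finset.sum_le_sum fun i hi => ?_)
  have hin : i ≤ n := by simpa [Nat.lt_succ_iff] using hi
  rw [abs_mul, abs_mul, Nat.abs_cast, mul_assoc]
  have h1 := mul_le_mul (hf i) (hh (n - i)) (abs_nonneg _) ((abs_nonneg _).trans (hf i))
  have h2 : M ^ n = M ^ i * M ^ (n - i) := by rw [← pow_add]; congr 1; omega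
  calc _ ≤ (n.choose i : ℝ) * (a i * w₁ * M ^ i * (c (n - i) * w₂ * M ^ (n - i))) := by gcongr
    _ = _ := by rw [h2]; ring


/-- **Derivative bound for `b_j(u)² u^{−α} g(u)`.**
Under the flexible-needlet assumptions and the regularity assumptions on `g`,
for every `N` there is `C > 0` such that for all `j ≥ 1` and `u ∈ [S_{j−1}, S_{j+1}]`,
`|dᴺ/duᴺ (b_j(u)² u^{−α} g(u))| ≤ C u^{−α} max{1/S_{j−1}^{N(1−β)}, 1/(S_j − S_{j−1})^N}`. -/
theorem derivative_bound_weighted_kernel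
    (S : ℕ → ℝ) (b : ℕ → ℝ → ℝ) (K : ℕ → ℝ)
    (g : ℝ → ℝ) (g₁ g₂ : ℝ) (A : ℕ → ℝ) (α β : ℝ)
    -- scale sequence assumptions
    (hS0 : S 0 = 1) (hSpos : ∀ j, 0 < S j) (hSmono : StrictMono S)
    (hStop : Filter.Tendsto S Filter.atTop Filter.atTop)
    (hSconv : ∀ j : ℕ, S (j + 1) - S j ≤ S (j + 2) - S (j + 1))
    -- kernel sequence assumptions
    (hbC : ∀ j, ContDiff ℝ (⊤ : ℕ∞) (b j))
    (hb01 : ∀ j, ∀ u : ℝ, 0 ≤ u → b j u ∈ Set.Icc (0 : ℝ) 1)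
    (hbderiv : ∀ j n : ℕ, 1 ≤ j → 1 ≤ n →
      ∀ u : ℝ, |iteratedDeriv n (b j) u| ≤ K n / (S j - S (j - 1)) ^ n)
    (hbsupp : ∀ j : ℕ, 1 ≤ j → ∀ u : ℝ, (u < S (j - 1) ∨ S (j + 1) < u) → b j u = 0)
    (hbval : ∀ j : ℕ, 1 ≤ j →
      b j (S (j - 1)) = 0 ∧ b j (S (j + 1)) = 0 ∧ b j (S j) = 1)
    (hbpart : ∀ u : ℝ, 1 ≤ u → ∑' j : ℕ, (b j u) ^ 2 = 1)
    -- assumptions on `g`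
    (hα : 2 < α) (hβ0 : 0 ≤ β) (hβ1 : β < 1)
    (hg12 : 0 < g₁) (hg21 : g₁ ≤ g₂)
    (hgC : ContDiffOn ℝ (⊤ : ℕ∞) g (Set.Ioi 0))
    (hgpos : ∀ u : ℝ, 0 < u → g₁ ≤ g u ∧ g u ≤ g₂)
    (hgder : ∀ r : ℕ, 1 ≤ r → ∀ u : ℝ, 1 ≤ u →
      |iteratedDeriv r g u| ≤ A r * u ^ (-(1 - β) * (r : ℝ))) :
    ∀ N : ℕ, ∃ C : ℝ, 0 < C ∧
      ∀ j : ℕ, 1 ≤ j → ∀ u : ℝ, S (j - 1) ≤ u → u ≤ S (j + 1) →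
        |iteratedDeriv N (fun v : ℝ => (b j v) ^ 2 * v ^ (-α) * g v) u| ≤
          C * u ^ (-α) *
            max (1 / S (j - 1) ^ ((N : ℝ) * (1 - β))) (1 / (S j - S (j - 1)) ^ N) := by
  intro N
  let a : ℕ → ℝ := fun n => max 1 |K n|
  let p : ℕ → ℝ := fun n => |(descPochhammer ℝ n).eval (-α)|
  let q : ℕ → ℝ := fun n => max g₂ |A n|
  let D : ℝ := leibC (leibC (leibC a a) p) q N
  refine ⟨max 1 D, by positivity, ?_⟩
  intro j hj u hu1 hu2
  have hSge : 1 ≤ S (j - 1) := by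
    rw [← hS0]; exact hSmono.monotone (Nat.zero_le _)
  have hSp : 0 < S (j - 1) := hSpos _
  have hu : 1 ≤ u := hSge.trans hu1
  have hu0 : 0 < u := by linarith
  have hΔ : 0 < S j - S (j - 1) := sub_pos.2 (hSmono (by omega))
  set m : ℝ := 1 / S (j - 1) ^ (1 - β) with hm
  set M : ℝ := max m (1 / (S j - S (j - 1))) with hM
  have hm0 : 0 < m := by positivity
  have hM0 : 0 < M := lt_max_of_lt_left hm0
  have hum : u ^ (-(1 - β)) ≤ m := by
    rw [hm, Real.rpow_neg hu0.le, ← one_div]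
    have : S (j - 1) ^ (1 - β) ≤ u ^ (1 - β) := Real.rpow_le_rpow hSp.le hu1 (by linarith)
    have h0 : 0 < S (j - 1) ^ (1 - β) := by positivity
    exact one_div_le_one_div_of_le h0 this
  have huM : u ^ (-(1 - β)) ≤ M := hum.trans (le_max_left _ _)
  have huM1 : u⁻¹ ≤ M := by
    refine le_trans ?_ huM
    rw [← Real.rpow_neg_one]
    exact Real.rpow_le_rpow_of_exponent_le hu (by linarith)
  have hbc : ∀ n : ℕ, ContDiffAt ℝ n (b j) u := fun n =>
    ((hbC j).contDiffAt).of_le (by exact_mod_cast le_top)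
  have hpc : ∀ n : ℕ, ContDiffAt ℝ n (fun v : ℝ => v ^ (-α)) u := fun n =>
    Real.contDiffAt_rpow_const_of_ne hu0.ne'
  have hgc : ∀ n : ℕ, ContDiffAt ℝ n g u := fun n =>
    (hgC.contDiffAt (Ioi_mem_nhds hu0)).of_le (by exact_mod_cast le_top)
  have hb : ∀ n, |iteratedDeriv n (b j) u| ≤ a n * 1 * M ^ n := by
    intro n
    rcases Nat.eq_zero_or_pos n with rfl | hn
    · have h := hb01 j u hu0.le
      simp only [iteratedDeriv_zero, pow_zero, mul_one]
      rw [abs_of_nonneg h.1]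
      exact h.2.trans (le_max_left _ _)
    · refine (hbderiv j n hj hn u).trans ?_
      have h1 : (1 / (S j - S (j - 1))) ^ n ≤ M ^ n :=
        pow_le_pow_left₀ (by positivity) (le_max_right _ _) n
      have h2 : K n ≤ a n := (le_abs_self _).trans (le_max_right _ _)
      have h3 : (0:ℝ) ≤ a n := le_trans zero_le_one (le_max_left _ _)
      calc K n / (S j - S (j - 1)) ^ n = K n * (1 / (S j - S (j - 1))) ^ n := by
            rw [one_div, inv_pow, div_eq_mul_inv]
        _ ≤ a n * M ^ n := mul_le_mul h2 h1 (by positivity) h3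
        _ = _ := by ring
  have hp : ∀ n, |iteratedDeriv n (fun v : ℝ => v ^ (-α)) u| ≤ p n * u ^ (-α) * M ^ n := by
    intro n
    rw [iteratedDeriv_eq_iterate, Real.iter_deriv_rpow_const, abs_mul,
      abs_of_pos (Real.rpow_pos_of_pos hu0 _), Real.rpow_sub hu0, Real.rpow_natCast,
      div_eq_mul_inv, ← inv_pow, ← mul_assoc]
    have h1 : u⁻¹ ^ n ≤ M ^ n := pow_le_pow_left₀ (by positivity) huM1 n
    exact mul_le_mul_of_nonneg_left h1 (by positivity)
  have hg : ∀ n, |iteratedDeriv n g u| ≤ q n * 1 * M ^ n := by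
    intro n
    rcases Nat.eq_zero_or_pos n with rfl | hn
    · have h := hgpos u hu0
      simp only [iteratedDeriv_zero, pow_zero, mul_one]
      rw [abs_of_nonneg (by linarith)]
      exact h.2.trans (le_max_left _ _)
    · refine (hgder n hn u hu).trans ?_
      have h1 : (u ^ (-(1 - β))) ^ n ≤ M ^ n := pow_le_pow_left₀ (by positivity) huM n
      have h2 : A n ≤ q n := (le_abs_self _).trans (le_max_right _ _)
      have h3 : (0:ℝ) ≤ q n := le_trans (abs_nonneg _) (le_max_right _ _)
      rw [Real.rpow_mul hu0.le, Real.rpow_natCast, mul_one]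
      exact mul_le_mul h2 h1 (by positivity) h3
  have e1 := leib_bound (b j) (b j) u a a 1 1 M hbc hbc hb hb
  have c1 : ∀ n : ℕ, ContDiffAt ℝ n (fun v => b j v * b j v) u := fun n => (hbc n).mul (hbc n)
  have e2 := leib_bound _ _ u _ p _ _ M c1 hpc e1 hp
  have c2 : ∀ n : ℕ, ContDiffAt ℝ n (fun v => b j v * b j v * v ^ (-α)) u :=
    fun n => (c1 n).mul (hpc n)
  have e3 := leib_bound _ _ u _ q _ _ M c2 hgc e2 hg N
  have hMN : M ^ N ≤
      max (1 / S (j - 1) ^ ((N : ℝ) * (1 - β))) (1 / (S j - S (j - 1)) ^ N) := by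
    rcases max_choice m (1 / (S j - S (j - 1))) with h | h
    · refine le_trans (le_of_eq ?_) (le_max_left _ _)
      rw [hM, h, hm, div_pow, one_pow, mul_comm (N : ℝ), Real.rpow_mul hSp.le, Real.rpow_natCast]
    · refine le_trans (le_of_eq ?_) (le_max_right _ _)
      rw [hM, h, div_pow, one_pow]
  have hfun : (fun v : ℝ => (b j v) ^ 2 * v ^ (-α) * g v) =
      fun v => b j v * b j v * v ^ (-α) * g v := by
    funext v; rw [sq]
  rw [hfun]
  refine e3.trans ?_
  have hw : 0 < u ^ (-α) := Real.rpow_pos_of_pos hu0 _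
  calc _ = D * u ^ (-α) * M ^ N := by simp only [D]; ring
    _ ≤ max 1 D * u ^ (-α) * M ^ N := by
        gcongr; exact le_max_right _ _
    _ ≤ _ := mul_le_mul_of_nonneg_left hMN (by positivity)
end

section
/- Let d ≥ 2 be an integer, let {S_j} be a scale sequence with bounded scale ratio S_{j+1} ≤ κ S_{j−1} for a fixed κ ≥ 1, let {b_j} satisfy the flexible-needlet assumptions, and let the angular power spectrum {C_ℓ} satisfy the regularity assumption with parameters α > 2 and β ∈ [0,1). Then for every N ∈ ℕ there exists C > 0 (independent of j and θ) such that for all j ≥ 1 and θ ∈ (0, π], |cos θ − 1|^N · |Φ_j(cos θ)| ≤ C · max{ 1/S_{j−1}^{2N(1−β)}, 1/(S_j − S_{j−1})^{2N} } · min{ (S_{j+1} − S_{j−1}) S_{j−1}^{d−α−1}, S_{j−1}^{d−α} }, where Φ_j(cos θ) = Σ_ℓ b_j(ℓ)² C_ℓ Z_{ℓ;d}(cos θ). -/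
noncomputable section

/-- `η_d = (d-1)/2`. -/
def etaD (d : ℕ) : ℝ := ((d : ℝ) - 1) / 2

/-- `ω_d = 2 π^((d+1)/2) / Γ((d+1)/2)`. -/
def omegaD (d : ℕ) : ℝ :=
  2 * Real.pi ^ (((d : ℝ) + 1) / 2) / Real.Gamma (((d : ℝ) + 1) / 2)

/-- Gegenbauer polynomials `G_ℓ^{(η)}`, defined by the three-term recurrence
`G_0 = 1`, `G_1(x) = 2ηx`,
`(ℓ+1) G_{ℓ+1}(x) = 2(ℓ+η) x G_ℓ(x) − (ℓ+2η−1) G_{ℓ−1}(x)`. -/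
def gegen (η : ℝ) : ℕ → ℝ → ℝ
  | 0 => fun _ => (1 : ℝ)
  | 1 => fun x => 2 * η * x
  | (n + 2) => fun x =>
      (2 * ((n : ℝ) + 1 + η) * x * gegen η (n + 1) x
        - ((n : ℝ) + 1 + 2 * η - 1) * gegen η n x) / ((n : ℝ) + 2)

/-- The zonal kernel `Z_{ℓ;d}(t) = ((ℓ+η_d)/(η_d ω_d)) G_ℓ^{(η_d)}(t)`. -/
def Zker (d : ℕ) (ℓ : ℕ) (t : ℝ) : ℝ :=
  (((ℓ : ℝ) + etaD d) / (etaD d * omegaD d)) * gegen (etaD d) ℓ t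


/-- Symbol-type class: finite differences up to order `n` gain powers of `1/M`. -/
def SymC (u0 M : ℝ) : ℕ → ℝ → (ℝ → ℝ) → Prop
  | 0, B, f => ∀ u, u0 ≤ u → |f u| ≤ B
  | (n + 1), B, f => (∀ u, u0 ≤ u → |f u| ≤ B) ∧ SymC u0 M n (B / M) (fun u => f (u + 1) - f u)

lemma SymC.bound {u0 M : ℝ} {n : ℕ} {B : ℝ} {f : ℝ → ℝ} (h : SymC u0 M n B f) :
    ∀ u, u0 ≤ u → |f u| ≤ B := by
  cases n with
  | zero => exact h
  | succ n => exact h.1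

lemma SymC.pred {u0 M : ℝ} {n : ℕ} : ∀ {B : ℝ} {f : ℝ → ℝ}, SymC u0 M (n + 1) B f →
    SymC u0 M n B f := by
  induction n with
  | zero => intro B f h; exact h.1
  | succ n ih => intro B f h; exact ⟨h.1, ih h.2⟩

lemma SymC.mono {u0 M : ℝ} (hM : 0 < M) {n : ℕ} : ∀ {B B' : ℝ} {f : ℝ → ℝ}, B ≤ B' →
    SymC u0 M n B f → SymC u0 M n B' f := by
  induction n with
  | zero => intro B B' f hB h u hu; exact (h u hu).trans hB
  | succ n ih =>
    intro B B' f hB h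
    exact ⟨fun u hu => (h.1 u hu).trans hB, ih (by gcongr) h.2⟩

lemma SymC.shift {u0 u1 M : ℝ} (c : ℝ) (hc : u0 ≤ u1 + c) {n : ℕ} : ∀ {B : ℝ} {f : ℝ → ℝ},
    SymC u0 M n B f → SymC u1 M n B (fun u => f (u + c)) := by
  induction n with
  | zero => intro B f h u hu; exact h _ (by linarith)
  | succ n ih =>
    intro B f h
    refine ⟨fun u hu => h.1 _ (by linarith), ?_⟩
    have := ih h.2
    convert this using 3
    ring_nf

lemma SymC.up {u0 u1 M : ℝ} (hc : u0 ≤ u1) {n : ℕ} {B : ℝ} {f : ℝ → ℝ}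
    (h : SymC u0 M n B f) : SymC u1 M n B f := by
  have := h.shift (u1 := u1) 0 (by linarith)
  simpa using this

lemma SymC.add {u0 M : ℝ} {n : ℕ} : ∀ {B B' : ℝ} {f g : ℝ → ℝ},
    SymC u0 M n B f → SymC u0 M n B' g → SymC u0 M n (B + B') (fun u => f u + g u) := by
  induction n with
  | zero =>
    intro B B' f g hf hg u hu
    exact (abs_add_le _ _).trans (add_le_add (hf u hu) (hg u hu))
  | succ n ih =>
    intro B B' f g hf hg
    refine ⟨fun u hu => (abs_add_le _ _).trans (add_le_add (hf.1 u hu) (hg.1 u hu)), ?_⟩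
    have := ih hf.2 hg.2
    rw [← add_div] at this
    convert this using 2
    ring

lemma SymC.mul {u0 M : ℝ} {n : ℕ} : ∀ {B B' : ℝ} {f g : ℝ → ℝ},
    SymC u0 M n B f → SymC u0 M n B' g → SymC u0 M n (2 ^ n * (B * B')) (fun u => f u * g u) := by
  induction n with
  | zero =>
    intro B B' f g hf hg u hu
    rw [abs_mul, pow_zero, one_mul]
    exact mul_le_mul (hf u hu) (hg u hu) (abs_nonneg _) ((abs_nonneg _).trans (hf u hu))
  | succ n ih =>
    intro B B' f g hf hg
    refine ⟨fun u hu => ?_, ?_⟩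
    · rw [abs_mul]
      have h1 : |f u| * |g u| ≤ B * B' :=
        mul_le_mul (hf.1 u hu) (hg.1 u hu) (abs_nonneg _) ((abs_nonneg _).trans (hf.1 u hu))
      have h0 : 0 ≤ B * B' := le_trans (by positivity) h1
      have h2 : (1 : ℝ) ≤ 2 ^ (n + 1) := one_le_pow₀ (by norm_num)
      nlinarith
    · have h1 := ih (hf.pred.shift (u1 := u0) 1 (by linarith)) hg.2
      have h2 := ih hf.2 hg.pred
      have h3 := h1.add h2
      convert h3 using 1
      · ring
      · ext u; ring

lemma SymC.const_mul {u0 M : ℝ} (c : ℝ) {n : ℕ} : ∀ {B : ℝ} {f : ℝ → ℝ},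
    SymC u0 M n B f → SymC u0 M n (|c| * B) (fun u => c * f u) := by
  induction n with
  | zero =>
    intro B f hf u hu
    rw [abs_mul]
    exact mul_le_mul_of_nonneg_left (hf u hu) (abs_nonneg _)
  | succ n ih =>
    intro B f hf
    refine ⟨fun u hu => ?_, ?_⟩
    · rw [abs_mul]
      exact mul_le_mul_of_nonneg_left (hf.1 u hu) (abs_nonneg _)
    · have := ih hf.2
      convert this using 1
      · ring
      · ext u; ring

lemma SymC.of_deriv {u0 M : ℝ} (n : ℕ) : ∀ {B : ℝ} (D : ℕ → ℝ → ℝ),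
    (∀ k u, u0 ≤ u → HasDerivAt (D k) (D (k + 1) u) u) →
    (∀ k, k ≤ n → ∀ u, u0 ≤ u → |D k u| ≤ B / M ^ k) → SymC u0 M n B (D 0) := by
  induction n with
  | zero => intro B D _ h u hu; simpa using h 0 le_rfl u hu
  | succ n ih =>
    intro B D hD h
    refine ⟨fun u hu => by simpa using h 0 (by omega) u hu, ?_⟩
    refine ih (fun k u => D k (u + 1) - D k u) ?_ ?_
    · intro k u hu
      have h1 : HasDerivAt (fun u => D k (u + 1)) (D (k + 1) (u + 1)) u := by
        have := (hD k (u + 1) (by linarith)).comp_add_const u 1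
        simpa using this
      exact h1.sub (hD k u hu)
    · intro k hk u hu
      have := (convex_Ici u0).norm_image_sub_le_of_norm_hasDerivWithin_le (f := D k)
        (f' := D (k + 1)) (C := B / M ^ (k + 1))
        (fun x hx => (hD k x hx).hasDerivWithinAt)
        (fun x hx => by simpa using h (k + 1) (by omega) x hx)
        (x := u) (y := u + 1) hu (show u0 ≤ u + 1 by linarith)
      simp only [Real.norm_eq_abs] at this
      have h1 : |u + 1 - u| = 1 := by simp
      rw [h1, mul_one] at this
      refine this.trans (le_of_eq ?_)
      rw [pow_succ', div_div]

/-- The coefficients of iterated derivatives of `x ^ p`. -/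
def powCoef (p : ℝ) : ℕ → ℝ
  | 0 => 1
  | (k + 1) => powCoef p k * (p - k)

lemma sym_rpow (p η : ℝ) (hp : p ≤ 0) (hη : 0 ≤ η) (n : ℕ) : ∃ C : ℝ, 0 ≤ C ∧
    ∀ S M u0 : ℝ, 1 ≤ S → 0 < M → M ≤ S → S / 2 ≤ u0 →
      SymC u0 M n (C * S ^ p) (fun u => (u + η) ^ p) := by
  refine ⟨∑ k ∈ Finset.range (n + 1), |powCoef p k| * (2⁻¹ : ℝ) ^ (p - k), by positivity, ?_⟩
  intro S M u0 hS hM hMS hu0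
  have key := SymC.of_deriv (u0 := u0) (M := M) n
    (B := (∑ k ∈ Finset.range (n + 1), |powCoef p k| * (2⁻¹ : ℝ) ^ (p - k)) * S ^ p)
    (fun k u => powCoef p k * (u + η) ^ (p - k)) ?_ ?_
  · simpa [powCoef] using key
  · intro k u hu
    have hpos : u + η ≠ 0 := by
      have : 0 < u := by linarith
      positivity
    have h1 : HasDerivAt (fun u : ℝ => u + η) 1 u := (hasDerivAt_id u).add_const η
    have h2 := (h1.rpow_const (p := p - k) (Or.inl hpos)).const_mul (powCoef p k)
    refine h2.congr_deriv ?_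
    simp only [powCoef]
    push_cast
    rw [show p - ((k : ℝ) + 1) = p - k - 1 by ring]
    ring
  · intro k hk u hu
    have hS0 : 0 < S := by linarith
    have hu1 : S * 2⁻¹ ≤ u + η := by linarith
    have hpk : p - k ≤ 0 := by
      have : (0 : ℝ) ≤ k := by positivity
      linarith
    have h1 : (u + η) ^ (p - k) ≤ (S * 2⁻¹) ^ (p - k) :=
      Real.rpow_le_rpow_of_nonpos (by positivity) hu1 hpk
    rw [Real.mul_rpow hS0.le (by norm_num)] at h1
    have h2 : S ^ (p - k) ≤ S ^ p / M ^ k := by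
      rw [Real.rpow_sub hS0, Real.rpow_natCast]
      gcongr
    have hnn : 0 ≤ (u + η) ^ (p - k) := Real.rpow_nonneg (le_trans (by positivity) hu1) _
    rw [abs_mul, abs_of_nonneg hnn]
    have h3 : |powCoef p k| * (2⁻¹ : ℝ) ^ (p - k) ≤
        ∑ k ∈ Finset.range (n + 1), |powCoef p k| * (2⁻¹ : ℝ) ^ (p - k) :=
      Finset.single_le_sum (f := fun k : ℕ => |powCoef p k| * (2⁻¹ : ℝ) ^ (p - k))
        (fun i _ => by positivity) (Finset.mem_range.2 (by omega))
    calc |powCoef p k| * (u + η) ^ (p - k)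
        ≤ |powCoef p k| * (S ^ (p - k) * (2⁻¹ : ℝ) ^ (p - k)) := by gcongr
      _ = (|powCoef p k| * (2⁻¹ : ℝ) ^ (p - k)) * S ^ (p - k) := by ring
      _ ≤ (∑ k ∈ Finset.range (n + 1), |powCoef p k| * (2⁻¹ : ℝ) ^ (p - k)) * (S ^ p / M ^ k) := by
          gcongr
      _ = _ := by ring

/-- The difference operator adjoint to multiplication by `x - 1`. -/
def Lop (η : ℝ) (f : ℝ → ℝ) : ℝ → ℝ := fun u =>
  (1 / 2) * (f (u + 1) - 2 * f u + f (u - 1)) + (η / 2) * (u + η) ^ (-1 : ℝ) * (f (u + 1) - f (u - 1))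

lemma sym_Lop (η : ℝ) (hη : 0 ≤ η) (n : ℕ) : ∃ C : ℝ, 0 ≤ C ∧
    ∀ S M u0 B : ℝ, ∀ f : ℝ → ℝ, 1 ≤ S → 0 < M → M ≤ S → S / 2 ≤ u0 →
      SymC u0 M (n + 2) B f → SymC (u0 + 1) M n (C * B / M ^ 2) (Lop η f) := by
  obtain ⟨W, hW0, hW⟩ := sym_rpow (-1) η (by norm_num) hη n
  refine ⟨1 / 2 + 2 ^ (n + 1) * (η / 2 * W), by positivity, ?_⟩
  intro S M u0 B f hS hM hMS hu0 hf
  have hB : 0 ≤ B := (abs_nonneg _).trans (hf.bound u0 le_rfl)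
  have h1 := hf.2.2.shift (u1 := u0 + 1) (-1) (by linarith)
  have h2 := hf.2.pred.shift (u1 := u0 + 1) (-1) (by linarith)
  have h3 := hf.2.pred.up (u1 := u0 + 1) (by linarith)
  have hw := (hW S M (u0 + 1) hS hM hMS (by linarith)).const_mul (η / 2)
  have h4 := (h1.const_mul (1 / 2)).add (hw.mul (h3.add h2))
  have h5 := h4.mono hM (B' := (1 / 2 + 2 ^ (n + 1) * (η / 2 * W)) * B / M ^ 2) ?_
  · convert h5 using 1
    ext u
    simp only [Lop]
    ring_nf
  · rw [abs_of_nonneg (by norm_num : (0 : ℝ) ≤ 1 / 2), abs_of_nonneg (by positivity : 0 ≤ η / 2)]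
    have hSM : S ^ (-1 : ℝ) ≤ 1 / M := by
      rw [Real.rpow_neg_one, one_div]
      gcongr
    calc 1 / 2 * (B / M / M) + 2 ^ n * (η / 2 * (W * S ^ (-1 : ℝ)) * (B / M + B / M))
        ≤ 1 / 2 * (B / M / M) + 2 ^ n * (η / 2 * (W * (1 / M)) * (B / M + B / M)) := by gcongr
      _ = _ := by field_simp; ring

lemma sym_Lop_iter (η : ℝ) (hη : 0 ≤ η) (N : ℕ) : ∀ n : ℕ, ∃ C : ℝ, 0 ≤ C ∧
    ∀ S M B : ℝ, ∀ f : ℝ → ℝ, 1 ≤ S → 0 < M → M ≤ S →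
      SymC (S / 2) M (n + 2 * N) B f →
        SymC (S / 2 + N) M n (C * B / M ^ (2 * N)) ((Lop η)^[N] f) := by
  induction N with
  | zero =>
    intro n
    exact ⟨1, by norm_num, fun S M B f _ _ _ h => by simpa using h⟩
  | succ N ih =>
    intro n
    obtain ⟨C1, hC1, h1⟩ := ih (n + 2)
    obtain ⟨C2, hC2, h2⟩ := sym_Lop η hη n
    refine ⟨C2 * C1, by positivity, ?_⟩
    intro S M B f hS hM hMS hf
    have hf' : SymC (S / 2) M (n + 2 + 2 * N) B f := by
      convert hf using 1; ring
    have h3 := h2 S M _ _ _ hS hM hMS (by simp) (h1 S M B f hS hM hMS hf')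
    rw [Function.iterate_succ_apply']
    convert h3 using 1
    · push_cast; ring
    · field_simp; ring

lemma Lop_iter_zero (η : ℝ) (f : ℝ → ℝ) (a c : ℝ) (hf : ∀ u, u < a ∨ c < u → f u = 0) (N : ℕ) :
    ∀ u, u < a - N ∨ c + N < u → (Lop η)^[N] f u = 0 := by
  induction N with
  | zero => simpa using hf
  | succ N ih =>
    intro u hu
    rw [Function.iterate_succ_apply']
    push_cast at hu
    have h1 : (Lop η)^[N] f u = 0 := ih u (by rcases hu with h | h; left; linarith; right; linarith)
    have h2 : (Lop η)^[N] f (u + 1) = 0 :=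
      ih _ (by rcases hu with h | h; left; linarith; right; linarith)
    have h3 : (Lop η)^[N] f (u - 1) = 0 :=
      ih _ (by rcases hu with h | h; left; linarith; right; linarith)
    simp [Lop, h1, h2, h3]

lemma gegen_rec (η : ℝ) (n : ℕ) (x : ℝ) : ((n : ℝ) + 2) * gegen η (n + 2) x =
    2 * ((n : ℝ) + 1 + η) * x * gegen η (n + 1) x - ((n : ℝ) + 2 * η) * gegen η n x := by
  rw [gegen]
  have : (n : ℝ) + 2 ≠ 0 := by positivity
  field_simp
  ring

lemma Lop_nat (η : ℝ) (hη : 0 < η) (f : ℝ → ℝ) (l : ℕ) : ((l : ℝ) + η) * Lop η f l =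
    (1 / 2) * (l * f (l - 1) + (l + 2 * η) * f (l + 1)) - (l + η) * f l := by
  have : (l : ℝ) + η ≠ 0 := by positivity
  rw [Lop, Real.rpow_neg_one]
  field_simp
  ring

lemma sum_by_parts (η : ℝ) (hη : 0 < η) (f : ℝ → ℝ) (x : ℝ) (R : ℕ) :
    ∑ l ∈ Finset.range (R + 1), ((x - 1) * (f l * ((l + η) * gegen η l x))
      - Lop η f l * ((l + η) * gegen η l x)) =
    (1 / 2) * (((R : ℝ) + 1) * f R * gegen η (R + 1) x - (R + 2 * η) * f (R + 1) * gegen η R x) := by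
  induction R with
  | zero =>
    have h := Lop_nat η hη f 0
    simp only [Nat.cast_zero, zero_add, zero_mul] at h
    simp only [zero_add, Finset.sum_range_one, gegen, Nat.cast_zero]
    linear_combination -h
  | succ R ih =>
    rw [Finset.sum_range_succ, ih]
    have h := Lop_nat η hη f (R + 1)
    have hr := gegen_rec η R x
    push_cast at h ⊢
    rw [show (R : ℝ) + 1 - 1 = R by ring] at h
    rw [show R + 1 + 1 = R + 2 from rfl]
    linear_combination (-gegen η (R + 1) x) * h - (1 / 2) * f (R + 1) * hr

lemma tsum_by_parts (d : ℕ) (hd : 2 ≤ d) (f : ℝ → ℝ) (c x : ℝ) (hf : ∀ u, c < u → f u = 0) :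
    (x - 1) * ∑' l : ℕ, f l * Zker d l x = ∑' l : ℕ, Lop (etaD d) f l * Zker d l x := by
  have hη : 0 < etaD d := by
    have : (2 : ℝ) ≤ d := by exact_mod_cast hd
    unfold etaD; linarith
  obtain ⟨R, hR⟩ := exists_nat_gt (c + 1)
  have h1 : ∀ l : ℕ, l ∉ Finset.range (R + 1) → f l * Zker d l x = 0 := by
    intro l hl
    have : (R : ℝ) + 1 ≤ l := by
      simp only [Finset.mem_range, not_lt] at hl; exact_mod_cast hl
    rw [hf _ (by linarith), zero_mul]
  have h2 : ∀ l : ℕ, l ∉ Finset.range (R + 1) → Lop (etaD d) f l * Zker d l x = 0 := by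
    intro l hl
    have : (R : ℝ) + 1 ≤ l := by
      simp only [Finset.mem_range, not_lt] at hl; exact_mod_cast hl
    simp only [Lop]
    rw [hf _ (by linarith), hf _ (by linarith), hf _ (by linarith)]
    simp
  rw [tsum_eq_sum h1, tsum_eq_sum h2]
  have h3 := sum_by_parts (etaD d) hη f x R
  rw [hf R (by linarith), hf (R + 1) (by linarith), Finset.sum_sub_distrib] at h3
  have h4 : ∀ F : ℝ → ℝ, ∑ l ∈ Finset.range (R + 1), F l * Zker d l x =
    (1 / (etaD d * omegaD d)) *
      ∑ l ∈ Finset.range (R + 1), F l * ((l + etaD d) * gegen (etaD d) l x) := by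
    intro F
    rw [Finset.mul_sum]
    refine Finset.sum_congr rfl fun l _ => ?_
    unfold Zker
    ring
  rw [h4, h4]
  rw [← Finset.mul_sum] at h3
  linear_combination (1 / (etaD d * omegaD d)) * h3

lemma tsum_by_parts_iter (d : ℕ) (hd : 2 ≤ d) (f : ℝ → ℝ) (a c x : ℝ)
    (hf : ∀ u, u < a ∨ c < u → f u = 0) (N : ℕ) :
    (x - 1) ^ N * ∑' l : ℕ, f l * Zker d l x =
      ∑' l : ℕ, (Lop (etaD d))^[N] f l * Zker d l x := by
  induction N with
  | zero => simp
  | succ N ih =>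
    rw [pow_succ', mul_assoc, ih, Function.iterate_succ_apply']
    exact tsum_by_parts d hd _ (c + N) x
      (fun u hu => Lop_iter_zero _ f a c hf N u (Or.inr hu))

/-- `(η)_k / k!`. -/
def pc (η : ℝ) : ℕ → ℝ
  | 0 => 1
  | (k + 1) => pc η k * (k + η) / (k + 1)

lemma pc_nonneg (η : ℝ) (hη : 0 ≤ η) (k : ℕ) : 0 ≤ pc η k := by
  induction k with
  | zero => simp [pc]
  | succ k ih => rw [pc]; positivity

/-- Power series of `(1 - z t)^(-η)`. -/
def PS (η : ℝ) (z : ℂ) : PowerSeries ℂ := PowerSeries.mk fun k => (pc η k : ℂ) * z ^ k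

open PowerSeries in
lemma PS_deriv (η : ℝ) (z : ℂ) : (1 - C z * X) * derivative ℂ (PS η z) = C ((η : ℂ) * z) * PS η z := by
  ext n
  have hk : ∀ k : ℕ, ((pc η (k + 1) : ℝ) : ℂ) * (k + 1) = pc η k * (k + η) := by
    intro k
    rw [pc]
    push_cast
    have : (k : ℂ) + 1 ≠ 0 := by exact_mod_cast Nat.succ_ne_zero k
    field_simp
  rw [sub_mul, one_mul, map_sub, mul_assoc, coeff_C_mul, coeff_C_mul, coeff_derivative]
  cases n with
  | zero =>
    have := hk 0
    simp [PS] at this ⊢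
    linear_combination z * this
  | succ n =>
    rw [coeff_succ_X_mul, coeff_derivative]
    have := hk (n + 1)
    simp only [PS, coeff_mk]
    push_cast at this ⊢
    linear_combination z ^ (n + 2) * this

open PowerSeries in
lemma gegen_eq (η : ℝ) (z w : ℂ) (x : ℝ) (hzw : z * w = 1) (hx : z + w = 2 * x) (n : ℕ) :
    ((gegen η n x : ℝ) : ℂ) = coeff n (PS η z * PS η w) := by
  set Q := PS η z * PS η w with hQ
  have hD : (1 - C (2 * (x : ℂ)) * X + X * X) * derivative ℂ Q =
      C (2 * η * x : ℂ) * Q - C (2 * η : ℂ) * (X * Q) := by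
    have h1 := PS_deriv η z
    have h2 := PS_deriv η w
    have h3 : (C z * C w : PowerSeries ℂ) = 1 := by rw [← map_mul, hzw, map_one]
    have h4 : (C (2 * (x : ℂ)) : PowerSeries ℂ) = C z + C w := by rw [← hx, map_add]
    have h5 : (C (2 * (η : ℂ) * x) : PowerSeries ℂ) = C (η : ℂ) * (C z + C w) := by
      rw [← h4, ← map_mul]; congr 1; ring
    have h6 : (C (2 * (η : ℂ)) : PowerSeries ℂ) = 2 * C (η : ℂ) := by
      rw [map_mul]; congr 1
    rw [hQ, Derivation.leibniz, h4, h5, h6]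
    simp only [smul_eq_mul]
    rw [map_mul] at h1 h2
    linear_combination (1 - C w * X) * PS η w * h1 + (1 - C z * X) * PS η z * h2 +
      (-2 * C (η : ℂ) * X * PS η z * PS η w - X * X * (PS η z * derivative ℂ (PS η w) + PS η w * derivative ℂ (PS η z))) * h3
  have hrec : ∀ n : ℕ, ((n : ℂ) + 2) * coeff (n + 2) Q =
      2 * (n + 1 + η) * x * coeff (n + 1) Q - (n + 2 * η) * coeff n Q := by
    intro n
    have := congrArg (coeff (n + 1)) hD
    simp only [add_mul, sub_mul, one_mul, map_add, map_sub, mul_assoc, coeff_succ_X_mul,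
      coeff_C_mul, coeff_derivative] at this
    cases n with
    | zero =>
      simp at this ⊢
      linear_combination this
    | succ n =>
      rw [coeff_succ_X_mul, coeff_derivative] at this
      push_cast at this ⊢
      linear_combination this
  have h0 : coeff 0 Q = 1 := by
    rw [hQ, coeff_mul]; simp [PS, pc]
  have h1 : coeff 1 Q = 2 * η * x := by
    rw [hQ, coeff_mul, Finset.Nat.antidiagonal_succ]; simp [PS, pc]
    linear_combination (η : ℂ) * hx
  induction n using Nat.twoStepInduction with
  | zero => rw [h0]; simp [gegen]
  | one => rw [h1]; simp [gegen]
  | more n ih1 ih2 =>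
    have hr := gegen_rec η n x
    have hr' : ((n : ℂ) + 2) * (gegen η (n + 2) x : ℝ) =
      2 * ((n : ℂ) + 1 + η) * x * (gegen η (n + 1) x : ℝ) - ((n : ℂ) + 2 * η) * (gegen η n x : ℝ) := by
      exact_mod_cast hr
    have hn : (n : ℂ) + 2 ≠ 0 := by exact_mod_cast Nat.succ_ne_zero (n + 1)
    apply mul_left_cancel₀ hn
    rw [hr', hrec, ih1, ih2]

open PowerSeries in
lemma gegen_abs_le (η : ℝ) (hη : 0 ≤ η) (θ : ℝ) (n : ℕ) :
    |gegen η n (Real.cos θ)| ≤ gegen η n 1 := by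
  have h1 := gegen_eq η (Complex.exp (θ * Complex.I)) (Complex.exp (-θ * Complex.I)) (Real.cos θ)
    (by rw [← Complex.exp_add]; simp) (by
      push_cast; rw [Complex.cos]; ring) n
  have h2 := gegen_eq η 1 1 1 (by simp) (by norm_num) n
  rw [coeff_mul] at h1 h2
  have h2' : gegen η n 1 = ∑ p ∈ Finset.HasAntidiagonal.antidiagonal n, pc η p.1 * pc η p.2 := by
    simp [PS] at h2
    exact_mod_cast h2
  have h3 : |gegen η n (Real.cos θ)| = ‖((gegen η n (Real.cos θ) : ℝ) : ℂ)‖ := by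
    rw [Complex.norm_real, Real.norm_eq_abs]
  rw [h3, h1, h2']
  refine (norm_sum_le _ _).trans (Finset.sum_le_sum fun p _ => le_of_eq ?_)
  have e1 : ‖Complex.exp (θ * Complex.I)‖ = 1 := Complex.norm_exp_ofReal_mul_I θ
  have e2 : ‖Complex.exp (-θ * Complex.I)‖ = 1 := by
    have := Complex.norm_exp_ofReal_mul_I (-θ)
    simpa using this
  simp only [PS, coeff_mk, norm_mul, norm_pow, e1, e2, one_pow, mul_one, Complex.norm_real,
    Real.norm_eq_abs, abs_of_nonneg (pc_nonneg η hη _)]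

lemma gegen_one (η : ℝ) (n : ℕ) : ((n : ℝ) + 1) * gegen η (n + 1) 1 = (n + 2 * η) * gegen η n 1 := by
  induction n with
  | zero => simp [gegen]
  | succ n ih =>
    have h := gegen_rec η n 1
    push_cast
    rw [show n + 1 + 1 = n + 2 from rfl]
    linear_combination h + ih

lemma gegen_bound (d : ℕ) (hd : 2 ≤ d) (θ : ℝ) (n : ℕ) :
    |gegen (etaD d) n (Real.cos θ)| ≤ ((n : ℝ) + 1) ^ (d - 2) := by
  have hd' : (2 : ℝ) ≤ d := by exact_mod_cast hd
  have hη : 0 ≤ etaD d := by unfold etaD; linarith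
  refine (gegen_abs_le _ hη θ n).trans ?_
  obtain ⟨m, rfl⟩ : ∃ m, d = m + 2 := ⟨d - 2, by omega⟩
  simp only [Nat.add_sub_cancel]
  have he : 2 * etaD (m + 2) = m + 1 := by unfold etaD; push_cast; ring
  induction n with
  | zero => simp [gegen]
  | succ n ih =>
    have h := gegen_one (etaD (m + 2)) n
    rw [he] at h
    have hn : (0 : ℝ) < (n : ℝ) + 1 := by positivity
    have hpos : 0 < 1 / ((n : ℝ) + 1) := by positivity
    have hb := one_add_mul_le_pow (a := 1 / ((n : ℝ) + 1)) (by linarith) m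
    have h2 : gegen (etaD (m + 2)) (n + 1) 1 = (1 + m * (1 / ((n : ℝ) + 1))) * gegen (etaD (m + 2)) n 1 := by
      field_simp
      linear_combination h
    rw [h2]
    have hg0 : 0 ≤ gegen (etaD (m + 2)) n 1 := (abs_nonneg _).trans (gegen_abs_le _ hη 0 n)
    calc (1 + m * (1 / ((n : ℝ) + 1))) * gegen (etaD (m + 2)) n 1
        ≤ (1 + 1 / ((n : ℝ) + 1)) ^ m * ((n : ℝ) + 1) ^ m := by gcongr
      _ = (((n + 1 : ℕ) : ℝ) + 1) ^ m := by
        rw [← mul_pow]; congr 1; push_cast; field_simp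

lemma hasDerivAt_iter (g : ℝ → ℝ) (u : ℝ) (hg : ContDiffAt ℝ (⊤ : ℕ∞) g u) (k : ℕ) :
    HasDerivAt (iteratedDeriv k g) (iteratedDeriv (k + 1) g u) u := by
  rw [iteratedDeriv_succ]
  have h := hg.differentiableAt_iteratedFDeriv (m := k) (by exact_mod_cast ENat.natCast_lt_top k)
  rw [iteratedDeriv_eq_equiv_comp]
  refine DifferentiableAt.hasDerivAt ?_
  rw [LinearIsometryEquiv.comp_differentiableAt_iff]
  exact h

lemma sym_b (f : ℝ → ℝ) (K : ℕ → ℝ) (D M u0 : ℝ) (hf : ContDiff ℝ (⊤ : ℕ∞) f)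
    (hM : 0 < M) (hMD : M ≤ D) (hu0 : 0 ≤ u0) (h01 : ∀ u, 0 ≤ u → |f u| ≤ 1)
    (hd : ∀ n : ℕ, 1 ≤ n → ∀ u, |iteratedDeriv n f u| ≤ K n / D ^ n) (n : ℕ) :
    SymC u0 M n (1 + ∑ k ∈ Finset.range (n + 1), |K k|) f := by
  have hs : 0 ≤ ∑ k ∈ Finset.range (n + 1), |K k| := Finset.sum_nonneg fun _ _ => abs_nonneg _
  have := SymC.of_deriv (u0 := u0) (M := M) n (B := 1 + ∑ k ∈ Finset.range (n + 1), |K k|)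
    (fun k => iteratedDeriv k f) (fun k u _ => hasDerivAt_iter f u hf.contDiffAt k) ?_
  · simpa using this
  · intro k hk u hu
    rcases Nat.eq_zero_or_pos k with rfl | hk0
    · simp only [iteratedDeriv_zero, pow_zero, div_one]
      linarith [h01 u (hu0.trans hu)]
    · have h3 : |K k| ≤ ∑ k ∈ Finset.range (n + 1), |K k| :=
        Finset.single_le_sum (f := fun k : ℕ => |K k|)
          (fun i _ => abs_nonneg _) (Finset.mem_range.2 (by omega))
      have hD : 0 < D := hM.trans_le hMD
      calc |iteratedDeriv k f u| ≤ K k / D ^ k := hd k hk0 u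
        _ ≤ |K k| / D ^ k := by gcongr; exact le_abs_self _
        _ ≤ |K k| / M ^ k := by gcongr
        _ ≤ _ := by gcongr; linarith

lemma sym_g (g : ℝ → ℝ) (A : ℕ → ℝ) (β g₁ g₂ S M : ℝ) (hβ0 : 0 ≤ β) (hβ1 : β < 1)
    (hg12 : 0 < g₁) (hg21 : g₁ ≤ g₂)
    (hgC : ContDiffOn ℝ (⊤ : ℕ∞) g (Set.Ioi 0))
    (hgpos : ∀ u : ℝ, 0 < u → g₁ ≤ g u ∧ g u ≤ g₂)
    (hgder : ∀ r : ℕ, 1 ≤ r → ∀ u : ℝ, 1 ≤ u →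
      |iteratedDeriv r g u| ≤ A r * u ^ (-(1 - β) * (r : ℝ)))
    (hS : 2 ≤ S) (hM : 0 < M) (hMS : M ≤ S ^ (1 - β)) (n : ℕ) :
    SymC (S / 2) M n (g₂ + ∑ k ∈ Finset.range (n + 1), |A k| * 2 ^ k) g := by
  have hs : 0 ≤ ∑ k ∈ Finset.range (n + 1), |A k| * 2 ^ k :=
    Finset.sum_nonneg fun _ _ => by positivity
  have := SymC.of_deriv (u0 := S / 2) (M := M) n
    (B := g₂ + ∑ k ∈ Finset.range (n + 1), |A k| * 2 ^ k)
    (fun k => iteratedDeriv k g) (fun k u hu => hasDerivAt_iter g u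
      (hgC.contDiffAt (Ioi_mem_nhds (by linarith))) k) ?_
  · simpa using this
  · intro k hk u hu
    rcases Nat.eq_zero_or_pos k with rfl | hk0
    · simp only [iteratedDeriv_zero, pow_zero, div_one]
      have := hgpos u (by linarith)
      rw [abs_of_nonneg (by linarith)]
      linarith
    · have h3 : |A k| * 2 ^ k ≤ ∑ k ∈ Finset.range (n + 1), |A k| * 2 ^ k :=
        Finset.single_le_sum (f := fun k : ℕ => |A k| * 2 ^ k)
          (fun i _ => by positivity) (Finset.mem_range.2 (by omega))
      have hup : 0 < u := by linarith
      have hS0 : 0 < S := by linarith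
      have h4 : u ^ (-(1 - β) * (k : ℝ)) ≤ 2 ^ k / M ^ k := by
        have h5 : M / 2 ≤ u ^ (1 - β) := by
          calc M / 2 ≤ S ^ (1 - β) / 2 := by gcongr
            _ ≤ S ^ (1 - β) / 2 ^ (1 - β) := by
                gcongr
                calc (2 : ℝ) ^ (1 - β) ≤ 2 ^ (1 : ℝ) :=
                      Real.rpow_le_rpow_of_exponent_le (by norm_num) (by linarith)
                  _ = 2 := by simp
            _ = (S / 2) ^ (1 - β) := by rw [Real.div_rpow hS0.le (by norm_num)]
            _ ≤ u ^ (1 - β) := by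
                apply Real.rpow_le_rpow (by positivity) hu; linarith
        rw [neg_mul, Real.rpow_neg hup.le, Real.rpow_mul hup.le, Real.rpow_natCast]
        rw [show (2 : ℝ) ^ k / M ^ k = ((M / 2) ^ k)⁻¹ by rw [div_pow, inv_div]]
        gcongr
      calc |iteratedDeriv k g u| ≤ A k * u ^ (-(1 - β) * (k : ℝ)) := hgder k hk0 u (by linarith)
        _ ≤ |A k| * u ^ (-(1 - β) * (k : ℝ)) := by gcongr; exact le_abs_self _
        _ ≤ |A k| * (2 ^ k / M ^ k) := by gcongr
        _ = |A k| * 2 ^ k / M ^ k := by ring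
        _ ≤ _ := by gcongr; linarith

lemma Zker_bound (d : ℕ) (hd : 2 ≤ d) : ∃ c : ℝ, 0 ≤ c ∧ ∀ (l : ℕ) (θ : ℝ),
    |Zker d l (Real.cos θ)| ≤ c * ((l : ℝ) + 1) ^ (d - 1) := by
  have hd' : (2 : ℝ) ≤ d := by exact_mod_cast hd
  have hη : 0 < etaD d := by unfold etaD; linarith
  have hω : 0 < omegaD d := by
    unfold omegaD
    have := Real.Gamma_pos_of_pos (s := ((d : ℝ) + 1) / 2) (by positivity)
    have := Real.pi_pos
    positivity
  refine ⟨(1 + etaD d) / (etaD d * omegaD d), by positivity, fun l θ => ?_⟩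
  unfold Zker
  rw [abs_mul, abs_of_nonneg (by positivity)]
  have h1 := gegen_bound d hd θ l
  have h2 : (l : ℝ) + etaD d ≤ (1 + etaD d) * (l + 1) := by
    have : (0 : ℝ) ≤ l := by positivity
    nlinarith
  calc ((l : ℝ) + etaD d) / (etaD d * omegaD d) * |gegen (etaD d) l (Real.cos θ)|
      ≤ ((1 + etaD d) * (l + 1)) / (etaD d * omegaD d) * ((l : ℝ) + 1) ^ (d - 2) := by gcongr
    _ = _ := by
      rw [show d - 1 = (d - 2) + 1 by omega, pow_succ]; ring

lemma sum_bound (d : ℕ) (hd : 2 ≤ d) (κ δ : ℝ) (hκ : 1 ≤ κ) (hδ : 0 < δ) (N : ℕ) :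
    ∃ C : ℝ, 0 ≤ C ∧ ∀ (S S' B θ : ℝ) (f : ℝ → ℝ), 1 ≤ S → S' ≤ κ * S → δ ≤ S' - S → 0 ≤ B →
      (∀ l : ℕ, |f l| ≤ B) → (∀ u, u < S - N ∨ S' + N < u → f u = 0) →
      |∑' l : ℕ, f l * Zker d l (Real.cos θ)| ≤ C * B * ((S' - S) * S ^ (d - 1)) := by
  obtain ⟨c, hc, hZ⟩ := Zker_bound d hd
  refine ⟨(1 + (2 * N + 1) / δ) * (c * (κ + N + 1) ^ (d - 1)), by positivity, ?_⟩
  intro S S' B θ f hS hS' hδS hB hfB hf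
  have h1 : ∀ l : ℕ, l ∉ Finset.Icc ⌈S - N⌉₊ ⌊S' + N⌋₊ → f l * Zker d l (Real.cos θ) = 0 := by
    intro l hl
    rw [hf l, zero_mul]
    by_contra hcon
    push Not at hcon
    apply hl
    rw [Finset.mem_Icc]
    exact ⟨Nat.ceil_le.2 hcon.1, Nat.le_floor hcon.2⟩
  rw [tsum_eq_sum h1]
  have hpos : 0 ≤ S' + N := by
    have : (0 : ℝ) ≤ N := by positivity
    linarith
  have h2 : ∀ l ∈ Finset.Icc ⌈S - N⌉₊ ⌊S' + N⌋₊, |f l * Zker d l (Real.cos θ)| ≤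
      B * (c * ((κ + N + 1) * S) ^ (d - 1)) := by
    intro l hl
    rw [Finset.mem_Icc] at hl
    have hl2 : (l : ℝ) ≤ S' + N := (Nat.le_floor_iff hpos).1 hl.2
    have hl3 : (l : ℝ) + 1 ≤ (κ + N + 1) * S := by
      have : (0 : ℝ) ≤ N := by positivity
      nlinarith
    rw [abs_mul]
    have := hZ l θ
    have hfl := hfB l
    calc |f l| * |Zker d l (Real.cos θ)| ≤ B * (c * ((l : ℝ) + 1) ^ (d - 1)) := by gcongr
      _ ≤ _ := by gcongr
  have h3 : ((Finset.Icc ⌈S - N⌉₊ ⌊S' + N⌋₊).card : ℝ) ≤ (1 + (2 * N + 1) / δ) * (S' - S) := by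
    have h4 : ((Finset.Icc ⌈S - N⌉₊ ⌊S' + N⌋₊).card : ℝ) ≤ S' - S + (2 * N + 1) := by
      rw [Nat.card_Icc]
      have ha := Nat.le_ceil (S - N)
      have hb := Nat.floor_le hpos
      rcases le_total ⌈S - N⌉₊ (⌊S' + N⌋₊ + 1) with h | h
      · rw [Nat.cast_sub h]; push_cast; linarith
      · rw [Nat.sub_eq_zero_of_le h]
        have : (0 : ℝ) ≤ N := by positivity
        simp; linarith
    have h5 : (2 * (N : ℝ) + 1) ≤ (2 * N + 1) / δ * (S' - S) := by
      calc (2 * (N : ℝ) + 1) = (2 * N + 1) / δ * δ := by field_simp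
        _ ≤ _ := by gcongr
    linarith
  calc |∑ l ∈ Finset.Icc ⌈S - N⌉₊ ⌊S' + N⌋₊, f l * Zker d l (Real.cos θ)|
      ≤ ∑ l ∈ Finset.Icc ⌈S - N⌉₊ ⌊S' + N⌋₊, |f l * Zker d l (Real.cos θ)| :=
        Finset.abs_sum_le_sum_abs _ _
    _ ≤ (Finset.Icc ⌈S - N⌉₊ ⌊S' + N⌋₊).card • (B * (c * ((κ + N + 1) * S) ^ (d - 1))) :=
        Finset.sum_le_card_nsmul _ _ _ h2
    _ ≤ ((1 + (2 * N + 1) / δ) * (S' - S)) * (B * (c * ((κ + N + 1) * S) ^ (d - 1))) := by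
        rw [nsmul_eq_mul]
        gcongr
    _ = _ := by rw [mul_pow]; ring

set_option maxHeartbeats 2000000 in
/-- **Localization of the needlet covariance kernel.**
Under the flexible-needlet assumptions, bounded scale ratio, and the power-spectrum
regularity assumption, for every `N` there is `C > 0` such that for all `j ≥ 1` and
`θ ∈ (0, π]`, `|cos θ − 1|^N |Φ_j(cos θ)| ≤ C max{S_{j−1}^{−2N(1−β)},
(S_j − S_{j−1})^{−2N}} · min{(S_{j+1} − S_{j−1}) S_{j−1}^{d−α−1}, S_{j−1}^{d−α}}`. -/
theorem needlet_covariance_localization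
    (d : ℕ) (hd : 2 ≤ d) (S : ℕ → ℝ) (b : ℕ → ℝ → ℝ) (K : ℕ → ℝ)
    (κ : ℝ) (Cl : ℕ → ℝ) (g : ℝ → ℝ) (g₁ g₂ : ℝ) (A : ℕ → ℝ) (α β : ℝ)
    -- scale sequence assumptions
    (hS0 : S 0 = 1) (hSpos : ∀ j, 0 < S j) (hSmono : StrictMono S)
    (hStop : Filter.Tendsto S Filter.atTop Filter.atTop)
    (hSconv : ∀ j : ℕ, S (j + 1) - S j ≤ S (j + 2) - S (j + 1))
    -- bounded scale ratio
    (hκ : 1 ≤ κ) (hratio : ∀ j : ℕ, 1 ≤ j → S (j + 1) ≤ κ * S (j - 1))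
    -- kernel sequence assumptions
    (hbC : ∀ j, ContDiff ℝ (⊤ : ℕ∞) (b j))
    (hb01 : ∀ j, ∀ u : ℝ, 0 ≤ u → b j u ∈ Set.Icc (0 : ℝ) 1)
    (hbderiv : ∀ j n : ℕ, 1 ≤ j → 1 ≤ n →
      ∀ u : ℝ, |iteratedDeriv n (b j) u| ≤ K n / (S j - S (j - 1)) ^ n)
    (hbsupp : ∀ j : ℕ, 1 ≤ j → ∀ u : ℝ, (u < S (j - 1) ∨ S (j + 1) < u) → b j u = 0)
    (hbval : ∀ j : ℕ, 1 ≤ j →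
      b j (S (j - 1)) = 0 ∧ b j (S (j + 1)) = 0 ∧ b j (S j) = 1)
    (hbpart : ∀ u : ℝ, 1 ≤ u → ∑' j : ℕ, (b j u) ^ 2 = 1)
    -- power spectrum regularity assumption
    (hα : 2 < α) (hβ0 : 0 ≤ β) (hβ1 : β < 1)
    (hg12 : 0 < g₁) (hg21 : g₁ ≤ g₂)
    (hgC : ContDiffOn ℝ (⊤ : ℕ∞) g (Set.Ioi 0))
    (hgpos : ∀ u : ℝ, 0 < u → g₁ ≤ g u ∧ g u ≤ g₂)
    (hgder : ∀ r : ℕ, 1 ≤ r → ∀ u : ℝ, 1 ≤ u →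
      |iteratedDeriv r g u| ≤ A r * u ^ (-(1 - β) * (r : ℝ)))
    (hCl : ∀ ℓ : ℕ, 1 ≤ ℓ → Cl ℓ = (ℓ : ℝ) ^ (-α) * g ℓ) :
    ∀ N : ℕ, ∃ C : ℝ, 0 < C ∧
      ∀ j : ℕ, 1 ≤ j → ∀ θ : ℝ, 0 < θ → θ ≤ Real.pi →
        |Real.cos θ - 1| ^ N *
            |∑' ℓ : ℕ, (b j (ℓ : ℝ)) ^ 2 * Cl ℓ * Zker d ℓ (Real.cos θ)| ≤
          C * max (1 / S (j - 1) ^ (2 * (N : ℝ) * (1 - β)))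
              (1 / (S j - S (j - 1)) ^ (2 * N)) *
            min ((S (j + 1) - S (j - 1)) * S (j - 1) ^ ((d : ℝ) - α - 1))
              (S (j - 1) ^ ((d : ℝ) - α)) := by
  intro N
  have hδ : 0 < S 1 - S 0 := sub_pos.2 (hSmono (by norm_num))
  have hinc : ∀ j : ℕ, S 1 - S 0 ≤ S (j + 1) - S j := by
    intro j
    induction j with
    | zero => exact le_rfl
    | succ j ih => exact ih.trans (hSconv j)
  have hd' : (2 : ℝ) ≤ d := by exact_mod_cast hd
  have hη : 0 ≤ etaD d := by unfold etaD; linarith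
  have hg2 : 0 < g₂ := hg12.trans_le hg21
  obtain ⟨C1, hC1, hsum⟩ := sum_bound d hd κ (S 1 - S 0) hκ hδ N
  obtain ⟨CL, hCL, hL⟩ := sym_Lop_iter (etaD d) hη N 0
  obtain ⟨CP, hCP, hP⟩ := sym_rpow (-α) 0 (by linarith) le_rfl (0 + 2 * N)
  obtain ⟨CB, hCBdef⟩ : ∃ CB, CB = 1 + ∑ k ∈ Finset.range (0 + 2 * N + 1), |K k| := ⟨_, rfl⟩
  obtain ⟨CG, hCGdef⟩ : ∃ CG, CG = g₂ + ∑ k ∈ Finset.range (0 + 2 * N + 1), |A k| * 2 ^ k :=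
    ⟨_, rfl⟩
  have hCB : 0 ≤ CB := by rw [hCBdef]; positivity
  have hCG : 0 ≤ CG := by rw [hCGdef]; positivity
  obtain ⟨CF, hCFdef⟩ : ∃ CF, CF = 2 ^ (0 + 2 * N) * ((2 ^ (0 + 2 * N) * (CB * CB)) *
    (2 ^ (0 + 2 * N) * (CP * CG))) := ⟨_, rfl⟩
  have hCF : 0 ≤ CF := by rw [hCFdef]; positivity
  refine ⟨κ * (C1 * (CL * CF) + 2 ^ N * C1 * g₂ * (4 * N + 2) ^ (2 * N)) + 1, by positivity, ?_⟩
  intro j hj θ _ _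
  obtain ⟨i, rfl⟩ : ∃ i, j = i + 1 := ⟨j - 1, by omega⟩
  have hratio' := hratio (i + 1) hj
  have hsupp := hbsupp (i + 1) hj
  have hder := fun n => hbderiv (i + 1) n hj
  have hi1 := hinc i
  have hi2 := hinc (i + 1)
  have hSi1 : 1 ≤ S i := hS0 ▸ hSmono.monotone (Nat.zero_le i)
  simp only [Nat.add_sub_cancel] at hratio' hsupp hder ⊢
  rw [show i + 1 + 1 = i + 2 from rfl] at *
  obtain ⟨s, hs⟩ : ∃ s, s = S i := ⟨_, rfl⟩
  obtain ⟨s', hs'⟩ : ∃ s', s' = S (i + 2) := ⟨_, rfl⟩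
  obtain ⟨D, hD⟩ : ∃ D, D = S (i + 1) - S i := ⟨_, rfl⟩
  have hDpos : 0 < D := by rw [hD]; linarith
  have hss : S 1 - S 0 ≤ s' - s := by rw [hs', hs]; linarith
  rw [← hD] at hder ⊢
  rw [← hs] at hratio' hsupp hSi1 ⊢
  rw [← hs'] at hratio' hsupp ⊢
  have hs0 : 0 < s := by linarith
  obtain ⟨F, hF⟩ : ∃ F : ℝ → ℝ, F = fun u => (b (i + 1) u * b (i + 1) u) * ((u + 0) ^ (-α) * g u) :=
    ⟨_, rfl⟩
  have hFsupp : ∀ u, u < s ∨ s' < u → F u = 0 := by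
    intro u hu
    simp [hF, hsupp u hu]
  have hterm : ∀ l : ℕ, b (i + 1) l ^ 2 * Cl l * Zker d l (Real.cos θ) =
      F l * Zker d l (Real.cos θ) := by
    intro l
    rcases Nat.eq_zero_or_pos l with rfl | hl
    · rw [hFsupp _ (Or.inl (by simpa using hs0)), hsupp _ (Or.inl (by simpa using hs0))]
      simp
    · rw [hCl l hl, hF]
      simp only [add_zero]
      ring
  rw [tsum_congr hterm]
  have hb1 : ∀ u, 0 ≤ u → |b (i + 1) u| ≤ 1 := by
    intro u hu
    have := hb01 (i + 1) u hu
    rw [abs_of_nonneg this.1]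
    exact this.2
  -- final comparison of the scale factor
  obtain ⟨P, hPdef⟩ : ∃ P, P = min ((s' - s) * s ^ ((d : ℝ) - α - 1)) (s ^ ((d : ℝ) - α)) := ⟨_, rfl⟩
  obtain ⟨Q, hQdef⟩ : ∃ Q, Q = max (1 / s ^ (2 * (N : ℝ) * (1 - β))) (1 / D ^ (2 * N)) := ⟨_, rfl⟩
  rw [← hPdef, ← hQdef]
  have hQ0 : 0 ≤ Q := by rw [hQdef]; exact le_max_of_le_right (by positivity)
  have hss0 : 0 < s' - s := by linarith
  have hP0 : 0 ≤ P := by rw [hPdef]; exact le_min (by positivity) (by positivity)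
  have hPow : s ^ (-α) * ((s' - s) * s ^ (d - 1)) ≤ κ * P := by
    have e1 : s ^ (-α) * s ^ (d - 1) = s ^ ((d : ℝ) - α - 1) := by
      rw [← Real.rpow_natCast, ← Real.rpow_add hs0, Nat.cast_sub (by omega)]
      congr 1; push_cast; ring
    have e2 : s ^ ((d : ℝ) - α) = s * s ^ ((d : ℝ) - α - 1) := by
      rw [Real.rpow_sub_one hs0.ne']; field_simp
    have e3 : 0 < s ^ ((d : ℝ) - α - 1) := by positivity
    have e4 : s ^ (-α) * ((s' - s) * s ^ (d - 1)) = (s' - s) * s ^ ((d : ℝ) - α - 1) := by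
      rw [← e1]; ring
    rw [e4, hPdef, mul_min_of_nonneg _ _ (by linarith)]
    refine le_min ?_ ?_
    · have : 0 < (s' - s) * s ^ ((d : ℝ) - α - 1) := by positivity
      nlinarith
    · rw [e2, ← mul_assoc]
      gcongr
      linarith
  rcases le_or_gt (4 * (N : ℝ) + 2) s with hbig | hsmall
  · obtain ⟨M, hMdef⟩ : ∃ M, M = min (s ^ (1 - β)) D := ⟨_, rfl⟩
    have hM : 0 < M := by rw [hMdef]; exact lt_min (by positivity) hDpos
    have hM1 : M ≤ s ^ (1 - β) := by rw [hMdef]; exact min_le_left _ _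
    have hM2 : M ≤ D := by rw [hMdef]; exact min_le_right _ _
    have hMs : M ≤ s := hM1.trans (by
      calc s ^ (1 - β) ≤ s ^ (1 : ℝ) := Real.rpow_le_rpow_of_exponent_le hSi1 (by linarith)
        _ = s := by simp)
    have hN0 : (0 : ℝ) ≤ N := by positivity
    have hMQ : 1 / M ^ (2 * N) ≤ Q := by
      rw [hQdef, hMdef]
      rcases min_cases (s ^ (1 - β)) D with ⟨h, _⟩ | ⟨h, _⟩
      · rw [h]
        refine le_max_of_le_left (le_of_eq ?_)
        rw [← Real.rpow_natCast, ← Real.rpow_mul hs0.le]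
        congr 2; push_cast; ring
      · rw [h]; exact le_max_right _ _
    have hsb := sym_b (b (i + 1)) K D M (s / 2) (hbC _) hM hM2 (by linarith) hb1 hder (0 + 2 * N)
    have hsg := sym_g g A β g₁ g₂ s M hβ0 hβ1 hg12 hg21 hgC hgpos hgder (by linarith) hM hM1
      (0 + 2 * N)
    have hsp := hP s M (s / 2) hSi1 hM hMs le_rfl
    rw [← hCBdef] at hsb
    rw [← hCGdef] at hsg
    have hsF : SymC (s / 2) M (0 + 2 * N) (CF * s ^ (-α)) F := by
      have := (hsb.mul hsb).mul (hsp.mul hsg)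
      rw [hF]
      convert this using 1
      rw [hCFdef]; ring
    have hLF := (hL s M _ F hSi1 hM hMs hsF).bound
    have hLsupp := Lop_iter_zero (etaD d) F s s' hFsupp N
    have hB0 : 0 ≤ CL * (CF * s ^ (-α)) / M ^ (2 * N) := by positivity
    have hfin := hsum s s' _ θ ((Lop (etaD d))^[N] F) hSi1 hratio' hss hB0 (by
      intro l
      by_cases hl : (l : ℝ) < s - N
      · rw [hLsupp _ (Or.inl hl), abs_zero]; exact hB0
      · exact hLF l (by push Not at hl; linarith)) hLsupp
    rw [← tsum_by_parts_iter d hd F s s' (Real.cos θ) hFsupp N, abs_mul, abs_pow] at hfin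
    calc _ ≤ _ := hfin
      _ = C1 * (CL * CF) * (1 / M ^ (2 * N)) * (s ^ (-α) * ((s' - s) * s ^ (d - 1))) := by ring
      _ ≤ C1 * (CL * CF) * Q * (κ * P) := by gcongr
      _ = (κ * (C1 * (CL * CF))) * Q * P := by ring
      _ ≤ _ := by
        gcongr
        have : 0 ≤ κ * (2 ^ N * C1 * g₂ * (4 * (N : ℝ) + 2) ^ (2 * N)) := by positivity
        linarith
  · have hcos : |Real.cos θ - 1| ≤ 2 := by
      have h1 := Real.neg_one_le_cos θ
      have h2 := Real.cos_le_one θ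
      rw [abs_le]; constructor <;> linarith
    have hfin := hsum s s' (g₂ * s ^ (-α)) θ F hSi1 hratio' hss (by positivity) (by
      intro l
      by_cases hl : (l : ℝ) < s
      · rw [hFsupp _ (Or.inl hl), abs_zero]; positivity
      · push Not at hl
        have hl0 : (0 : ℝ) < l := by linarith
        have hgl := hgpos l hl0
        have hbl := hb1 l hl0.le
        rw [hF]
        simp only [add_zero, abs_mul]
        rw [abs_of_nonneg (hg12.le.trans hgl.1), abs_of_nonneg (Real.rpow_nonneg hl0.le (-α))]
        have hr : (l : ℝ) ^ (-α) ≤ s ^ (-α) :=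
          Real.rpow_le_rpow_of_nonpos hs0 hl (by linarith)
        have hgn : 0 ≤ g l := hg12.le.trans hgl.1
        calc |b (i + 1) l| * |b (i + 1) l| * ((l : ℝ) ^ (-α) * g l)
            ≤ 1 * 1 * (s ^ (-α) * g₂) := by gcongr; exact hgl.2
          _ = _ := by ring) (by
      intro u hu
      have hN0 : (0 : ℝ) ≤ N := by positivity
      exact hFsupp u (by rcases hu with h | h; left; linarith; right; linarith))
    have hQ1 : 1 ≤ (4 * (N : ℝ) + 2) ^ (2 * N) * Q := by
      have hle : s ^ (2 * (N : ℝ) * (1 - β)) ≤ (4 * (N : ℝ) + 2) ^ (2 * N) := by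
        have hN0 : (0 : ℝ) ≤ N := by positivity
        calc s ^ (2 * (N : ℝ) * (1 - β)) ≤ s ^ (2 * (N : ℝ)) :=
              Real.rpow_le_rpow_of_exponent_le hSi1 (by nlinarith)
          _ = s ^ (2 * N) := by rw [← Real.rpow_natCast]; push_cast; rfl
          _ ≤ _ := by gcongr
      have hp : 0 < s ^ (2 * (N : ℝ) * (1 - β)) := by positivity
      calc 1 = s ^ (2 * (N : ℝ) * (1 - β)) * (1 / s ^ (2 * (N : ℝ) * (1 - β))) := by field_simp
        _ ≤ (4 * (N : ℝ) + 2) ^ (2 * N) * Q := by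
          gcongr
          rw [hQdef]; exact le_max_left _ _
    calc |Real.cos θ - 1| ^ N * |∑' l : ℕ, F l * Zker d l (Real.cos θ)|
        ≤ 2 ^ N * (C1 * (g₂ * s ^ (-α)) * ((s' - s) * s ^ (d - 1))) := by gcongr
      _ = 2 ^ N * C1 * g₂ * (s ^ (-α) * ((s' - s) * s ^ (d - 1))) := by ring
      _ ≤ 2 ^ N * C1 * g₂ * (κ * P) := by gcongr
      _ ≤ 2 ^ N * C1 * g₂ * (κ * P) * ((4 * (N : ℝ) + 2) ^ (2 * N) * Q) :=
          le_mul_of_one_le_right (by positivity) hQ1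
      _ = (κ * (2 ^ N * C1 * g₂ * (4 * (N : ℝ) + 2) ^ (2 * N))) * Q * P := by ring
      _ ≤ _ := by
        gcongr
        have : 0 ≤ κ * (C1 * (CL * CF)) := by positivity
        linarith
end
end

section
/- Let {S_j} be a scale sequence and define the explicit construction: φ(t) = exp(−1/(1−t²)) for t ∈ (−1,1) and φ(t) = 0 otherwise; C_Φ = ∫_{−1}^{1} φ(t) dt; Φ(u) = 0 for u ≤ −1, Φ(u) = (1/C_Φ)∫_{−1}^{u} φ(t) dt for u ∈ (−1,1), and Φ(u) = 1 for u ≥ 1; τ_j(u) = (S_j + S_{j−1} − 2u)/(S_j − S_{j−1}); a_j(u) = 1 for u ∈ [0, S_{j−1}], a_j(u) = Φ(τ_j(u)) for u ∈ (S_{j−1}, S_j], a_j(u) = 0 for u > S_j; and b_j(u) = √(a_{j+1}(u) − a_j(u)). Then for every j ≥ 1, the function b_j is C^∞ on (0, ∞). -/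
noncomputable section

/-- `φ(t) = exp(−1/(1−t²))` for `t ∈ (−1,1)`, `0` otherwise. -/
def phiFun (t : ℝ) : ℝ :=
  if -1 < t ∧ t < 1 then Real.exp (-1 / (1 - t ^ 2)) else 0

/-- `C_Φ = ∫_{−1}^{1} φ(t) dt`. -/
def CPhi : ℝ := ∫ t in (-1 : ℝ)..1, phiFun t

/-- `Φ(u) = 0` for `u ≤ −1`, `(1/C_Φ)∫_{−1}^{u} φ` for `u ∈ (−1,1)`, `1` for `u ≥ 1`. -/
def PhiFun (u : ℝ) : ℝ :=
  if u ≤ -1 then 0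
  else if u < 1 then (∫ t in (-1 : ℝ)..u, phiFun t) / CPhi
  else 1

/-- The linear change of variable `τ_j(u) = (S_j + S_{j−1} − 2u)/(S_j − S_{j−1})`. -/
def tauFun (S : ℕ → ℝ) (j : ℕ) (u : ℝ) : ℝ :=
  (S j + S (j - 1) - 2 * u) / (S j - S (j - 1))

/-- `a_j(u) = 1` on `[0, S_{j−1}]`, `Φ(τ_j(u))` on `(S_{j−1}, S_j]`, `0` for `u > S_j`. -/
def aFun (S : ℕ → ℝ) (j : ℕ) (u : ℝ) : ℝ :=
  if u ≤ S (j - 1) then 1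
  else if u ≤ S j then PhiFun (tauFun S j u)
  else 0

/-- The window function `b_j(u) = √(a_{j+1}(u) − a_j(u))`. -/
def bFun (S : ℕ → ℝ) (j : ℕ) (u : ℝ) : ℝ :=
  Real.sqrt (aFun S (j + 1) u - aFun S j u)

lemma phiFun_eq (t : ℝ) : phiFun t = expNegInvGlue (1 - t ^ 2) := by
  unfold phiFun expNegInvGlue
  by_cases h : -1 < t ∧ t < 1
  · have : ¬ (1 - t ^ 2 ≤ 0) := by nlinarith [h.1, h.2]
    rw [if_pos h, if_neg this]
    congr 1
    rw [neg_div, one_div]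
  · have : 1 - t ^ 2 ≤ 0 := by
      by_contra hc
      push Not at hc
      exact h ⟨by nlinarith, by nlinarith⟩
    rw [if_neg h, if_pos this]

lemma phiFun_contDiff : ContDiff ℝ (⊤ : ℕ∞) phiFun := by
  have : phiFun = fun t => expNegInvGlue (1 - t ^ 2) := funext phiFun_eq
  rw [this]
  exact expNegInvGlue.contDiff.comp (by fun_prop)

lemma phiFun_cont : Continuous phiFun := phiFun_contDiff.continuous

lemma phiFun_nonneg (t : ℝ) : 0 ≤ phiFun t := by
  unfold phiFun; split_ifs <;> positivity

lemma phiFun_pos {t : ℝ} (h : -1 < t) (h' : t < 1) : 0 < phiFun t := by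
  unfold phiFun; rw [if_pos ⟨h, h'⟩]; positivity

lemma phiFun_neg (t : ℝ) : phiFun (-t) = phiFun t := by
  rw [phiFun_eq, phiFun_eq, neg_sq]

lemma phiFun_zero {t : ℝ} (h : t ≤ -1 ∨ 1 ≤ t) : phiFun t = 0 := by
  unfold phiFun
  rw [if_neg]
  rintro ⟨h1, h2⟩
  rcases h with h | h <;> linarith

/-- Unnormalised primitive. -/
def FF (u : ℝ) : ℝ := ∫ t in (-1 : ℝ)..u, phiFun t

lemma FF_hasDerivAt (u : ℝ) : HasDerivAt FF (phiFun u) u :=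
  intervalIntegral.integral_hasDerivAt_right (phiFun_cont.intervalIntegrable _ _)
    (phiFun_cont.stronglyMeasurableAtFilter _ _) phiFun_cont.continuousAt

lemma FF_contDiff : ContDiff ℝ (⊤ : ℕ∞) FF := by
  rw [contDiff_infty_iff_deriv]
  refine ⟨fun u => (FF_hasDerivAt u).differentiableAt, ?_⟩
  have : deriv FF = phiFun := funext fun u => (FF_hasDerivAt u).deriv
  rw [this]; exact phiFun_contDiff

lemma FF_mono : Monotone FF :=
  monotone_of_deriv_nonneg (fun u => (FF_hasDerivAt u).differentiableAt)
    (fun u => by rw [(FF_hasDerivAt u).deriv]; exact phiFun_nonneg u)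

lemma FF_neg_one : FF (-1) = 0 := by simp [FF]

lemma FF_of_le {u : ℝ} (h : u ≤ -1) : FF u = 0 := by
  unfold FF
  have : ∫ t in (-1 : ℝ)..u, phiFun t = ∫ t in (-1 : ℝ)..u, (0 : ℝ) := by
    apply intervalIntegral.integral_congr
    intro x hx
    rw [Set.uIcc_of_ge h] at hx
    exact phiFun_zero (Or.inl hx.2)
  rw [this]; simp

lemma FF_of_ge {u : ℝ} (h : 1 ≤ u) : FF u = CPhi := by
  unfold FF CPhi
  rw [← intervalIntegral.integral_add_adjacent_intervals
    (phiFun_cont.intervalIntegrable (-1) 1) (phiFun_cont.intervalIntegrable 1 u)]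
  have : ∫ t in (1 : ℝ)..u, phiFun t = ∫ t in (1 : ℝ)..u, (0 : ℝ) := by
    apply intervalIntegral.integral_congr
    intro x hx
    rw [Set.uIcc_of_le h] at hx
    exact phiFun_zero (Or.inr hx.1)
  rw [this]; simp

lemma FF_pos {u : ℝ} (h : -1 < u) : 0 < FF u := by
  have h1 : 0 < FF (min u 0) := by
    unfold FF
    apply intervalIntegral.intervalIntegral_pos_of_pos_on
      (phiFun_cont.intervalIntegrable _ _)
    · intro x hx
      exact phiFun_pos hx.1 (by have := hx.2; have := min_le_right u 0; linarith)
    · exact lt_min h (by norm_num)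
  exact h1.trans_le (FF_mono (min_le_left _ _))

lemma CPhi_pos : 0 < CPhi := by
  rw [← FF_of_ge le_rfl]; exact FF_pos (by norm_num)

lemma FF_symm (u : ℝ) : CPhi - FF u = FF (-u) := by
  have h1 : FF (-u) = ∫ t in u..1, phiFun t := by
    unfold FF
    rw [← intervalIntegral.integral_comp_neg]
    simp [phiFun_neg]
  rw [h1]
  unfold CPhi FF
  rw [← intervalIntegral.integral_add_adjacent_intervals
    (phiFun_cont.intervalIntegrable (-1) u) (phiFun_cont.intervalIntegrable u 1)]
  ring

lemma PhiFun_eq (u : ℝ) : PhiFun u = FF u / CPhi := by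
  unfold PhiFun
  split_ifs with h1 h2
  · rw [FF_of_le h1]; simp
  · rfl
  · rw [FF_of_ge (not_lt.mp h2), div_self CPhi_pos.ne']

/-- `s = 1/(1-t²)`. -/
def sF (t : ℝ) : ℝ := (1 - t ^ 2)⁻¹

/-- `q = φ/F`. -/
def qF (t : ℝ) : ℝ := phiFun t / FF t

/-- `w = √F`. -/
def wF (t : ℝ) : ℝ := Real.sqrt (FF t)

lemma sF_ge {t : ℝ} (h : -1 < t) (h' : t < 0) : 1 ≤ sF t := by
  unfold sF
  exact (one_le_inv₀ (by nlinarith)).2 (by nlinarith)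

lemma sF_hasDerivAt {t : ℝ} (h : -1 < t) (h' : t < 0) :
    HasDerivAt sF (2 * t * sF t * sF t) t := by
  have h0 : 1 - t ^ 2 ≠ 0 := by nlinarith
  have h1 : HasDerivAt (fun t : ℝ => 1 - t ^ 2) (-(2 * t)) t := by
    simpa using (hasDerivAt_pow 2 t).const_sub 1
  have := h1.inv h0
  refine HasDerivAt.congr_deriv this ?_
  unfold sF
  field_simp

lemma phiFun_eq_exp {t : ℝ} (h : -1 < t) (h' : t < 0) : phiFun t = Real.exp (-sF t) := by
  unfold phiFun sF
  rw [if_pos ⟨h, by linarith⟩]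
  congr 1
  rw [neg_div, one_div]

lemma phiFun_hasDerivAt {t : ℝ} (h : -1 < t) (h' : t < 0) :
    HasDerivAt phiFun (-2 * t * sF t * sF t * phiFun t) t := by
  have h1 := (sF_hasDerivAt h h').neg.exp
  have h2 : phiFun =ᶠ[nhds t] fun t => Real.exp (-sF t) := by
    filter_upwards [Ioo_mem_nhds h h'] with x hx
    exact phiFun_eq_exp hx.1 hx.2
  have h3 := h1.congr_of_eventuallyEq h2
  refine HasDerivAt.congr_deriv h3 ?_
  rw [phiFun_eq_exp h h']
  simp only [Pi.neg_apply]
  ring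

lemma qF_hasDerivAt {t : ℝ} (h : -1 < t) (h' : t < 0) :
    HasDerivAt qF (qF t * (-2 * t * sF t * sF t + (-1) * qF t)) t := by
  have := (phiFun_hasDerivAt h h').div (FF_hasDerivAt t) (FF_pos h).ne'
  refine HasDerivAt.congr_deriv this ?_
  have := (FF_pos h).ne'
  unfold qF
  field_simp
  ring

lemma wF_hasDerivAt {t : ℝ} (h : -1 < t) :
    HasDerivAt wF (wF t * (qF t / 2)) t := by
  have := (FF_hasDerivAt t).sqrt (FF_pos h).ne'
  refine HasDerivAt.congr_deriv this ?_
  have h1 := Real.sqrt_pos.2 (FF_pos h)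
  have h2 := Real.sq_sqrt (FF_pos h).le
  have h3 := (FF_pos h).ne'
  unfold qF wF
  field_simp
  rw [h2]

lemma qF_nonneg {t : ℝ} (h : -1 < t) : 0 ≤ qF t :=
  div_nonneg (phiFun_nonneg t) (FF_pos h).le

lemma qF_le {t : ℝ} (h : -1 < t) (h' : t < 0) : qF t ≤ 6 * sF t ^ 2 := by
  have hm : MonotoneOn (fun t => 6 * FF t - phiFun t * (1 - t ^ 2) ^ 2) (Set.Icc (-1) 0) := by
    apply monotoneOn_of_hasDerivWithinAt_nonneg (convex_Icc _ _)
      (f' := fun t => 6 * phiFun t - (-2 * t * sF t * sF t * phiFun t * (1 - t ^ 2) ^ 2 +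
        phiFun t * (2 * (1 - t ^ 2) * (-(2 * t)))))
    · have := FF_contDiff.continuous
      have := phiFun_cont
      fun_prop
    · intro x hx
      rw [interior_Icc] at hx
      apply HasDerivAt.hasDerivWithinAt
      have h1 : HasDerivAt (fun t : ℝ => 1 - t ^ 2) (-(2 * x)) x := by
        simpa using (hasDerivAt_pow 2 x).const_sub 1
      have h2 := h1.pow 2
      have := ((FF_hasDerivAt x).const_mul 6).sub ((phiFun_hasDerivAt hx.1 hx.2).mul h2)
      refine HasDerivAt.congr_deriv this ?_
      simp
    · intro x hx
      rw [interior_Icc] at hx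
      have h0 : 1 - x ^ 2 ≠ 0 := by nlinarith [hx.1, hx.2]
      have h1 : sF x * sF x * (1 - x ^ 2) ^ 2 = 1 := by
        unfold sF; field_simp
      have h2 : 6 * phiFun x - (-2 * x * sF x * sF x * phiFun x * (1 - x ^ 2) ^ 2 +
        phiFun x * (2 * (1 - x ^ 2) * (-(2 * x)))) =
          phiFun x * (6 + 2 * x * (sF x * sF x * (1 - x ^ 2) ^ 2) + 4 * x * (1 - x ^ 2)) := by
        ring
      rw [h2, h1]
      apply mul_nonneg (phiFun_nonneg x)
      nlinarith [hx.1, hx.2, mul_nonneg (neg_nonneg.2 hx.2.le) (sq_nonneg x)]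
  have := hm (Set.left_mem_Icc.2 (by norm_num)) ⟨h.le, h'.le⟩ h.le
  simp only [FF_neg_one] at this
  have h4 : phiFun t * (1 - t ^ 2) ^ 2 ≤ 6 * FF t := by
    norm_num at this; linarith
  unfold qF sF
  rw [div_le_iff₀ (FF_pos h), inv_pow]
  have h5 : 0 < (1 - t ^ 2) ^ 2 := by
    have : 0 < 1 - t ^ 2 := by nlinarith
    positivity
  rw [mul_right_comm, ← div_eq_mul_inv, le_div_iff₀ h5]
  exact h4

lemma wF_le {t : ℝ} (h : -1 < t) (h' : t < 0) : wF t ≤ Real.exp (-sF t / 2) := by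
  have h1 : FF t ≤ Real.exp (-sF t) := by
    have h2 : ‖∫ x in (-1 : ℝ)..t, phiFun x‖ ≤ Real.exp (-sF t) * |t - (-1)| := by
      apply intervalIntegral.norm_integral_le_of_norm_le_const
      intro x hx
      rw [Set.uIoc_of_le h.le] at hx
      rw [Real.norm_of_nonneg (phiFun_nonneg x),
        phiFun_eq_exp hx.1 (hx.2.trans_lt h'), Real.exp_le_exp, neg_le_neg_iff]
      unfold sF
      apply inv_anti₀
      · nlinarith [hx.1, hx.2]
      · nlinarith [hx.1, hx.2]
    have h3 : FF t ≤ ‖∫ x in (-1 : ℝ)..t, phiFun x‖ := le_abs_self _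
    have h4 : |t - (-1)| ≤ 1 := by rw [abs_le]; constructor <;> linarith
    have h5 := Real.exp_pos (-sF t)
    nlinarith
  unfold wF
  rw [Real.sqrt_le_left (Real.exp_pos _).le, ← Real.exp_nat_mul]
  convert h1 using 2
  push_cast; ring

/-- The algebra of coefficient functions. -/
inductive Coef : (ℝ → ℝ) → Prop
  | const (c : ℝ) : Coef (fun _ => c)
  | id : Coef (fun t => t)
  | s : Coef sF
  | q : Coef qF
  | add {f g : ℝ → ℝ} : Coef f → Coef g → Coef (fun t => f t + g t)
  | mul {f g : ℝ → ℝ} : Coef f → Coef g → Coef (fun t => f t * g t)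

lemma Coef.deriv {c : ℝ → ℝ} (hc : Coef c) :
    ∃ c', Coef c' ∧ ∀ t, -1 < t → t < 0 → HasDerivAt c (c' t) t := by
  induction hc with
  | const c => exact ⟨_, .const 0, fun t _ _ => hasDerivAt_const t c⟩
  | id => exact ⟨_, .const 1, fun t _ _ => hasDerivAt_id t⟩
  | s => exact ⟨_, (((Coef.const 2).mul .id).mul .s).mul .s, fun t h h' => sF_hasDerivAt h h'⟩
  | q => exact ⟨_, Coef.q.mul (((((Coef.const (-2)).mul .id).mul .s).mul .s).add
      ((Coef.const (-1)).mul .q)), fun t h h' => qF_hasDerivAt h h'⟩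
  | add hf hg ihf ihg =>
    obtain ⟨f', hf', hfd⟩ := ihf
    obtain ⟨g', hg', hgd⟩ := ihg
    exact ⟨_, hf'.add hg', fun t h h' => (hfd t h h').add (hgd t h h')⟩
  | mul hf hg ihf ihg =>
    obtain ⟨f', hf', hfd⟩ := ihf
    obtain ⟨g', hg', hgd⟩ := ihg
    exact ⟨_, (hf'.mul hg).add (hf.mul hg'), fun t h h' => (hfd t h h').mul (hgd t h h')⟩

lemma Coef.bound {c : ℝ → ℝ} (hc : Coef c) :
    ∃ (K : ℝ) (N : ℕ), 0 ≤ K ∧ ∀ t, -1 < t → t < 0 → |c t| ≤ K * sF t ^ N := by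
  induction hc with
  | const c => exact ⟨|c|, 0, abs_nonneg _, fun t _ _ => by simp⟩
  | id => exact ⟨1, 0, by norm_num, fun t h h' => by
      rw [abs_le]; constructor <;> simp <;> linarith⟩
  | s => exact ⟨1, 1, by norm_num, fun t h h' => by
      rw [abs_of_nonneg (by linarith [sF_ge h h'])]; simp⟩
  | q => exact ⟨6, 2, by norm_num, fun t h h' => by
      rw [abs_of_nonneg (qF_nonneg h)]; exact qF_le h h'⟩
  | add hf hg ihf ihg =>
    obtain ⟨K, N, hK, hf'⟩ := ihf
    obtain ⟨L, M, hL, hg'⟩ := ihg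
    refine ⟨K + L, N + M, by positivity, fun t h h' => ?_⟩
    have hs := sF_ge h h'
    have h1 : sF t ^ N ≤ sF t ^ (N + M) := pow_le_pow_right₀ hs (by omega)
    have h2 : sF t ^ M ≤ sF t ^ (N + M) := pow_le_pow_right₀ hs (by omega)
    have h3 := mul_le_mul_of_nonneg_left h1 hK
    have h4 := mul_le_mul_of_nonneg_left h2 hL
    have h5 := hf' t h h'
    have h6 := hg' t h h'
    refine (abs_add_le _ _).trans ?_
    rw [add_mul]; linarith
  | mul hf hg ihf ihg =>
    obtain ⟨K, N, hK, hf'⟩ := ihf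
    obtain ⟨L, M, hL, hg'⟩ := ihg
    refine ⟨K * L, N + M, by positivity, fun t h h' => ?_⟩
    have hs := sF_ge h h'
    rw [abs_mul, pow_add, mul_mul_mul_comm]
    exact mul_le_mul (hf' t h h') (hg' t h h') (abs_nonneg _) (by positivity)

lemma Coef.flat {c : ℝ → ℝ} (hc : Coef c) :
    ∃ K : ℝ, ∀ t, -1 < t → t < 0 → |wF t * c t| ≤ K * (t + 1) ^ 2 := by
  obtain ⟨K, N, hK, hb⟩ := hc.bound
  refine ⟨K * (2 ^ (N + 2) * (N + 2).factorial) * 4, fun t h h' => ?_⟩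
  have hs := sF_ge h h'
  have hs0 : 0 < sF t := by linarith
  have hw0 : 0 ≤ wF t := Real.sqrt_nonneg _
  have h1 := Real.pow_div_factorial_le_exp (sF t / 2) (by positivity) (N + 2)
  set A : ℝ := 2 ^ (N + 2) * (N + 2).factorial with hA
  have hA0 : 0 < A := by positivity
  have h2 : sF t ^ (N + 2) ≤ A * Real.exp (sF t / 2) := by
    rw [div_pow, div_div, div_le_iff₀ (by positivity)] at h1
    linarith
  have h3 : wF t * sF t ^ (N + 2) ≤ A := by
    calc wF t * sF t ^ (N + 2) ≤ Real.exp (-sF t / 2) * (A * Real.exp (sF t / 2)) :=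
          mul_le_mul (wF_le h h') h2 (by positivity) (Real.exp_pos _).le
      _ = A * Real.exp (-sF t / 2 + sF t / 2) := by rw [Real.exp_add]; ring
      _ = A := by rw [neg_div, neg_add_cancel, Real.exp_zero, mul_one]
  have h4 : (sF t)⁻¹ ≤ 2 * (t + 1) := by
    unfold sF; rw [inv_inv]; nlinarith
  have h4' : 0 < (sF t)⁻¹ := by positivity
  have h5 : (sF t)⁻¹ ^ 2 ≤ (2 * (t + 1)) ^ 2 := pow_le_pow_left₀ h4'.le h4 2
  have h6 : wF t * sF t ^ N = wF t * sF t ^ (N + 2) * (sF t)⁻¹ ^ 2 := by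
    rw [pow_add]; field_simp
  rw [abs_mul, abs_of_nonneg hw0]
  calc wF t * |c t| ≤ wF t * (K * sF t ^ N) := mul_le_mul_of_nonneg_left (hb t h h') hw0
    _ = K * (wF t * sF t ^ (N + 2) * (sF t)⁻¹ ^ 2) := by rw [← h6]; ring
    _ ≤ K * (A * (2 * (t + 1)) ^ 2) :=
        mul_le_mul_of_nonneg_left (mul_le_mul h3 h5 (by positivity) hA0.le) hK
    _ = _ := by ring

lemma wF_of_le {t : ℝ} (h : t ≤ -1) : wF t = 0 := by
  unfold wF; rw [FF_of_le h, Real.sqrt_zero]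

lemma Coef.w_deriv {c : ℝ → ℝ} (hc : Coef c) :
    ∃ c', Coef c' ∧ ∀ t, t < 0 → HasDerivAt (fun t => wF t * c t) (wF t * c' t) t := by
  obtain ⟨d, hd, hdd⟩ := hc.deriv
  refine ⟨_, ((Coef.q.mul (.const (1 / 2))).mul hc).add hd, fun t h' => ?_⟩
  rcases lt_trichotomy t (-1) with h | h | h
  · rw [wF_of_le h.le, zero_mul]
    apply (hasDerivAt_const t (0 : ℝ)).congr_of_eventuallyEq
    filter_upwards [Iio_mem_nhds h] with x hx
    rw [wF_of_le (le_of_lt hx), zero_mul]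
  · subst h
    rw [wF_of_le le_rfl, zero_mul]
    obtain ⟨K, hK⟩ := hc.flat
    rw [hasDerivAt_iff_isLittleO]
    simp only [wF_of_le le_rfl, zero_mul, sub_zero, smul_zero]
    have h1 : (fun t => wF t * c t) =O[nhds (-1)] (fun x : ℝ => (x - -1) ^ 2) := by
      apply Asymptotics.IsBigO.of_bound |K|
      filter_upwards [Iio_mem_nhds h'] with x hx
      rw [Real.norm_eq_abs, Real.norm_eq_abs, abs_of_nonneg (sq_nonneg (x - -1))]
      rcases le_or_gt x (-1) with h2 | h2
      · rw [wF_of_le h2, zero_mul, abs_zero]; positivity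
      · refine (hK x h2 hx).trans ?_
        rw [sub_neg_eq_add]
        exact mul_le_mul_of_nonneg_right (le_abs_self K) (sq_nonneg _)
    refine h1.trans_isLittleO ?_
    simpa using Asymptotics.isLittleO_pow_sub_sub (-1 : ℝ) (m := 2) (by norm_num)
  · refine HasDerivAt.congr_deriv ((wF_hasDerivAt h).mul (hdd t h h')) ?_
    ring

lemma Coef.w_contDiffOn (n : ℕ) : ∀ {c : ℝ → ℝ}, Coef c →
    ContDiffOn ℝ n (fun t => wF t * c t) (Set.Iio 0) := by
  induction n with
  | zero =>
    intro c hc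
    obtain ⟨c', _, hd⟩ := hc.w_deriv
    simp only [Nat.cast_zero, contDiffOn_zero]
    exact fun t ht => (hd t ht).continuousAt.continuousWithinAt
  | succ n ih =>
    intro c hc
    obtain ⟨c', hc', hd⟩ := hc.w_deriv
    push_cast
    rw [contDiffOn_succ_iff_deriv_of_isOpen isOpen_Iio]
    refine ⟨fun t ht => (hd t ht).differentiableAt.differentiableWithinAt, by simp, ?_⟩
    exact (ih hc').congr fun t ht => (hd t ht).deriv

lemma wF_contDiff : ContDiff ℝ (⊤ : ℕ∞) wF := by
  rw [contDiff_iff_contDiffAt]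
  intro t
  rcases lt_or_ge t 0 with h | h
  · have h1 : ContDiffOn ℝ (⊤ : ℕ∞) wF (Set.Iio 0) := by
      rw [contDiffOn_infty]
      intro n
      simpa using (Coef.const 1).w_contDiffOn n
    exact h1.contDiffAt (Iio_mem_nhds h)
  · exact FF_contDiff.contDiffAt.sqrt (FF_pos (by linarith)).ne'

lemma aFun_eq (S : ℕ → ℝ) (j : ℕ) (h : S (j - 1) < S j) (u : ℝ) :
    aFun S j u = PhiFun (tauFun S j u) := by
  have hd : 0 < S j - S (j - 1) := by linarith
  unfold aFun
  split_ifs with h1 h2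
  · have : 1 ≤ tauFun S j u := by
      unfold tauFun; rw [le_div_iff₀ hd]; linarith
    rw [PhiFun_eq, FF_of_ge this, div_self CPhi_pos.ne']
  · rfl
  · have : tauFun S j u ≤ -1 := by
      unfold tauFun; rw [div_le_iff₀ hd]; linarith
    rw [PhiFun_eq, FF_of_le this, zero_div]

lemma bFun_eq (S : ℕ → ℝ) (hS : StrictMono S) (j : ℕ) (hj : 1 ≤ j) (u : ℝ) :
    bFun S j u = wF (-tauFun S j u) * wF (tauFun S (j + 1) u) / CPhi := by
  have h1 : S (j - 1) < S j := hS (by omega)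
  have h2 : S (j + 1 - 1) < S (j + 1) := hS (by omega)
  have hC := CPhi_pos
  have hd1 : 0 < S j - S (j - 1) := by linarith
  have hd2 : 0 < S (j + 1) - S j := by simpa using h2
  have hq : Real.sqrt CPhi * Real.sqrt CPhi = CPhi := Real.mul_self_sqrt hC.le
  have hq0 := Real.sqrt_pos.2 hC
  unfold bFun
  rw [aFun_eq S j h1, aFun_eq S (j + 1) h2, PhiFun_eq, PhiFun_eq, ← sub_div,
    Real.sqrt_div' _ hC.le]
  unfold wF
  have key : ∀ x : ℝ, x / Real.sqrt CPhi = x * Real.sqrt CPhi / CPhi := by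
    intro x
    rw [div_eq_div_iff hq0.ne' hC.ne', mul_assoc, hq]
  rw [key]
  rcases le_total u (S j) with h | h
  · have : 1 ≤ tauFun S (j + 1) u := by
      unfold tauFun; simp only [Nat.add_sub_cancel]; rw [le_div_iff₀ hd2]; linarith
    rw [FF_of_ge this, FF_symm]
  · have : tauFun S j u ≤ -1 := by
      unfold tauFun; rw [div_le_iff₀ hd1]; linarith
    rw [FF_of_le this, FF_of_ge (u := -tauFun S j u) (by linarith), sub_zero, mul_comm]

/-- **Smoothness of the explicitly constructed windows.**
For a scale sequence `S`, each window `b_j` of the explicit construction is `C^∞`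
on `(0, ∞)`. -/
theorem bFun_contDiffOn
    (S : ℕ → ℝ)
    (hS0 : S 0 = 1) (hSpos : ∀ j, 0 < S j) (hSmono : StrictMono S)
    (hStop : Filter.Tendsto S Filter.atTop Filter.atTop)
    (hSconv : ∀ j : ℕ, S (j + 1) - S j ≤ S (j + 2) - S (j + 1)) :
    ∀ j : ℕ, 1 ≤ j → ContDiffOn ℝ (⊤ : ℕ∞) (bFun S j) (Set.Ioi (0 : ℝ)) := by
  intro j hj
  have h : bFun S j = fun u => wF (-tauFun S j u) * wF (tauFun S (j + 1) u) / CPhi :=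
    funext (bFun_eq S hSmono j hj)
  have ht : ∀ i, ContDiff ℝ (⊤ : ℕ∞) (tauFun S i) := by
    intro i
    unfold tauFun
    fun_prop
  rw [h]
  exact (((wF_contDiff.comp (ht j).neg).mul (wF_contDiff.comp (ht (j + 1)))).div_const
    CPhi).contDiffOn
end
end
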